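/- There exists a separable infinite compact Hausdorff space L such that L does not have the Grothendieck property but L has the ℓ1-Grothendieck property. -/

import Mathlib

open MeasureTheory Filter Topology Set
open scoped ENNReal

namespace JNP

variable {K : Type*} [TopologicalSpace K] [MeasurableSpace K] [BorelSpace K]

/-- The total variation norm of a signed Borel measure. -/
noncomputable def tvNorm (μ : SignedMeasure K) : ℝ :=
  (μ.totalVariation Set.univ).toReal

/-- A signed Borel measure is Radon if its total variation is a regular measure. -/
def IsRadon (μ : SignedMeasure K) : Prop :=
  μ.totalVariation.Regular

/-- The integral of a function against a signed measure. -/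
noncomputable def integ (μ : SignedMeasure K) (f : K → ℝ) : ℝ :=
  ∫ x, f x ∂μ.toJordanDecomposition.posPart -
    ∫ x, f x ∂μ.toJordanDecomposition.negPart

/-- The support of a signed measure: the set of points all of whose open
neighbourhoods have nonzero total variation. -/
def msupport (μ : SignedMeasure K) : Set K :=
  {x : K | ∀ U : Set K, IsOpen U → x ∈ U → μ.totalVariation U ≠ 0}

/-- Weak* convergence of a sequence of signed measures: convergence of the integrals of
every continuous real-valued function. -/
def WeakStarTendsto (μs : ℕ → SignedMeasure K) (μ : SignedMeasure K) : Prop :=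
  ∀ f : C(K, ℝ), Tendsto (fun n => integ (μs n) f) atTop (𝓝 (integ μ f))

/-- A sequence of signed measures is weak* null if the integral of every continuous
real-valued function tends to `0`. -/
def WeakStarNull (μs : ℕ → SignedMeasure K) : Prop :=
  ∀ f : C(K, ℝ), Tendsto (fun n => integ (μs n) f) atTop (𝓝 (0 : ℝ))

/-- Weak convergence of a sequence of signed measures: convergence under every bounded
linear functional on the Banach space of signed measures with the total variation norm
(which, for Radon measures, is `C(K)*` by the Riesz representation theorem). -/
def WeakTendsto (μs : ℕ → SignedMeasure K) (μ : SignedMeasure K) : Prop :=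
  ∀ φ : SignedMeasure K →ₗ[ℝ] ℝ,
    (∃ C : ℝ, ∀ ν : SignedMeasure K, |φ ν| ≤ C * tvNorm ν) →
    Tendsto (fun n => φ (μs n)) atTop (𝓝 (φ μ))

variable (K) in
/-- The Grothendieck property: every weak* convergent sequence of signed Radon measures
is weakly convergent. -/
def GrothendieckProp : Prop :=
  ∀ (μs : ℕ → SignedMeasure K) (μ : SignedMeasure K),
    (∀ n, IsRadon (μs n)) → IsRadon μ → WeakStarTendsto μs μ → WeakTendsto μs μ

variable (K) in
/-- The ℓ₁-Grothendieck property: every weak* convergent sequence of countably supported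
signed Radon measures is weakly convergent. -/
def Ell1Grothendieck : Prop :=
  ∀ (μs : ℕ → SignedMeasure K) (μ : SignedMeasure K),
    (∀ n, IsRadon (μs n)) → (∀ n, (msupport (μs n)).Countable) →
    IsRadon μ → WeakStarTendsto μs μ → WeakTendsto μs μ

variable (K) in
/-- The Δ-Grothendieck property: every weak* convergent sequence of finitely supported
signed Radon measures is weakly convergent. -/
def DeltaGrothendieck : Prop :=
  ∀ (μs : ℕ → SignedMeasure K) (μ : SignedMeasure K),
    (∀ n, IsRadon (μs n)) → (∀ n, (msupport (μs n)).Finite) →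
    IsRadon μ → WeakStarTendsto μs μ → WeakTendsto μs μ

variable (K) in
/-- The finitely supported Josefson–Nissenzweig property: there is a weak* null sequence of
finitely supported signed Radon measures of total variation norm one. -/
def fsJNP : Prop :=
  ∃ μs : ℕ → SignedMeasure K,
    (∀ n, IsRadon (μs n)) ∧ (∀ n, (msupport (μs n)).Finite) ∧
    (∀ n, tvNorm (μs n) = 1) ∧ WeakStarNull μs

variable (K) in
/-- The countably supported Josefson–Nissenzweig property: there is a weak* null sequence of
countably supported signed Radon measures of total variation norm one. -/
def csJNP : Prop :=
  ∃ μs : ℕ → SignedMeasure K,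
    (∀ n, IsRadon (μs n)) ∧ (∀ n, (msupport (μs n)).Countable) ∧
    (∀ n, tvNorm (μs n) = 1) ∧ WeakStarNull μs

end JNP

namespace JNP

section Mass
variable {Z : Type*}

/-- The mass which the absolute value of a real function puts on a set. -/
noncomputable def mass (c : Z → ℝ) (S : Set Z) : ℝ := ∑' z, S.indicator (fun z => |c z|) z

theorem summable_mass {c : Z → ℝ} (hc : Summable c) (S : Set Z) :
    Summable (S.indicator fun z => |c z|) :=
  hc.abs.indicator S

theorem mass_nonneg (c : Z → ℝ) (S : Set Z) : 0 ≤ mass c S :=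
  tsum_nonneg fun z => indicator_nonneg (fun _ _ => abs_nonneg _) z

theorem mass_mono {c : Z → ℝ} (hc : Summable c) {S T : Set Z} (h : S ⊆ T) :
    mass c S ≤ mass c T :=
  (summable_mass hc S).tsum_le_tsum
    (fun z => indicator_le_indicator_of_subset h (fun _ => abs_nonneg _) z) (summable_mass hc T)

theorem mass_biUnion_le {ι : Type*} {c : Z → ℝ} (hc : Summable c) (s : Finset ι)
    (S : ι → Set Z) : mass c (⋃ i ∈ s, S i) ≤ ∑ i ∈ s, mass c (S i) := by
  unfold mass
  rw [← Summable.tsum_finsetSum fun i _ => summable_mass hc (S i)]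
  refine (summable_mass hc _).tsum_le_tsum (fun z => ?_)
    (summable_sum fun i _ => summable_mass hc (S i))
  have h0 : ∀ j ∈ s, 0 ≤ (S j).indicator (fun z => |c z|) z :=
    fun j _ => indicator_nonneg (fun _ _ => abs_nonneg _) z
  by_cases hz : z ∈ ⋃ i ∈ s, S i
  · obtain ⟨i, hi, hzi⟩ := mem_iUnion₂.1 hz
    have := Finset.single_le_sum h0 hi
    rw [indicator_of_mem hz]
    simpa [hzi] using this
  · rw [indicator_of_notMem hz]
    exact Finset.sum_nonneg h0

theorem mass_union_le {c : Z → ℝ} (hc : Summable c) (S T : Set Z) :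
    mass c (S ∪ T) ≤ mass c S + mass c T := by
  unfold mass
  rw [← (summable_mass hc S).tsum_add (summable_mass hc T)]
  refine (summable_mass hc _).tsum_le_tsum (fun z => ?_)
    ((summable_mass hc S).add (summable_mass hc T))
  by_cases h1 : z ∈ S <;> by_cases h2 : z ∈ T <;> simp [h1, h2]

theorem sum_mass_le {ι : Type*} {c : Z → ℝ} (hc : Summable c) (s : Finset ι)
    (S : ι → Set Z) (hS : (s : Set ι).PairwiseDisjoint S) :
    ∑ i ∈ s, mass c (S i) ≤ ∑' z, |c z| := by
  unfold mass
  rw [← Summable.tsum_finsetSum fun i _ => summable_mass hc (S i)]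
  refine (summable_sum fun i _ => summable_mass hc (S i)).tsum_le_tsum (fun z => ?_) hc.abs
  by_cases h : ∃ i ∈ s, z ∈ S i
  · obtain ⟨i, hi, hz⟩ := h
    rw [Finset.sum_eq_single_of_mem i hi]
    · simp [hz]
    · intro j hj hji
      exact indicator_of_notMem (fun hz' => (hS hj hi hji).le_bot ⟨hz', hz⟩) _
  · push Not at h
    rw [Finset.sum_eq_zero fun i hi => indicator_of_notMem (h i hi) _]
    exact abs_nonneg _

theorem mass_finset (c : Z → ℝ) (F : Finset Z) : mass c (F : Set Z) = ∑ z ∈ F, |c z| := by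
  unfold mass
  rw [tsum_eq_sum (s := F) (fun z hz => indicator_of_notMem (by simpa using hz) _)]
  exact Finset.sum_congr rfl fun z hz => indicator_of_mem (by simpa using hz) _

theorem exists_mass_compl_lt {c : Z → ℝ} (hc : Summable c) {ρ : ℝ} (hρ : 0 < ρ) :
    ∃ F : Finset Z, mass c (F : Set Z)ᶜ < ρ := by
  have h := hc.abs.hasSum.eventually (Ioi_mem_nhds (show ∑' z, |c z| - ρ < ∑' z, |c z| by linarith))
  obtain ⟨F, hF⟩ := h.exists
  refine ⟨F, ?_⟩
  have h1 : mass c (F : Set Z) + mass c (F : Set Z)ᶜ = ∑' z, |c z| := by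
    unfold mass
    rw [← (summable_mass hc _).tsum_add (summable_mass hc _)]
    exact tsum_congr fun z => congrFun (indicator_self_add_compl _ _) z
  rw [mass_finset] at h1
  beta_reduce at hF
  linarith

theorem abs_tsum_indicator_sub_le {c : Z → ℝ} (hc : Summable c) {S T U : Set Z}
    (h : ∀ z, z ∉ U → (z ∈ S ↔ z ∈ T)) :
    |∑' z, S.indicator c z - ∑' z, T.indicator c z| ≤ mass c U := by
  rw [← (hc.indicator S).tsum_sub (hc.indicator T)]
  have hs : Summable fun z => ‖S.indicator c z - T.indicator c z‖ :=
    ((hc.indicator S).sub (hc.indicator T)).abs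
  refine (norm_tsum_le_tsum_norm hs).trans (hs.tsum_le_tsum (fun z => ?_) (summable_mass hc U))
  rw [Real.norm_eq_abs]
  by_cases hU : z ∈ U
  · by_cases h1 : z ∈ S <;> by_cases h2 : z ∈ T <;> simp [h1, h2, hU]
  · by_cases h1 : z ∈ S
    · simp [h1, (h z hU).1 h1, hU]
    · have h2 : z ∉ T := fun h2 => h1 ((h z hU).2 h2)
      simp [h1, h2, hU]

end Mass

theorem exists_pairwiseDisjoint_mem {Y : Type*} (F : Finset (Ultrafilter Y)) :
    ∃ A : Ultrafilter Y → Set Y, (∀ p, A p ∈ p) ∧ (F : Set (Ultrafilter Y)).PairwiseDisjoint A := by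
  obtain ⟨U, hU, hd⟩ := (F.finite_toSet).t2_separation
  refine ⟨fun p => pure ⁻¹' U p, fun p => ?_, fun p hp q hq hpq => ?_⟩
  · exact (Ultrafilter.tendsto_pure_self p) ((hU p).2.mem_nhds (hU p).1)
  · exact (hd hp hq hpq).preimage _

section GlidingHump

variable {Y Z : Type*} {u : Z → Ultrafilter Y} {c : ℕ → Z → ℝ}
  {Adm : ℕ → Set Y → Prop} {T : ℕ → Set Z}

/-- Pairwise disjoint finite sets carrying almost all the mass of infinitely many terms of
a pointwise null sequence. -/
theorem exists_disjoint_finsets (hs : ∀ k, Summable (c k))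
    (hp : ∀ z, Tendsto (fun k => c k z) atTop (𝓝 0))
    {T : Set Z} (hT : Tendsto (fun k => mass (c k) Tᶜ) atTop (𝓝 0))
    {ρ : ℝ} (hρ : 0 < ρ) {A : Set ℕ} (hA : ∃ᶠ k in atTop, k ∈ A) :
    ∃ (k : ℕ → ℕ) (F : ℕ → Finset Z), (∀ a, k a ∈ A) ∧ (∀ a, (F a : Set Z) ⊆ T) ∧
      (∀ a, mass (c (k a)) (F a : Set Z)ᶜ < ρ) ∧ ∀ a b, a < b → Disjoint (F a) (F b) := by
  classical
  obtain ⟨f, hf, hf'⟩ := exists_seq_of_forall_finset_exists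
    (α := ℕ × Finset Z)
    (fun x => x.1 ∈ A ∧ (x.2 : Set Z) ⊆ T ∧ mass (c x.1) (x.2 : Set Z)ᶜ < ρ)
    (fun x y => Disjoint x.2 y.2) (fun s _ => by
      let E : Finset Z := s.biUnion Prod.snd
      have hE : Tendsto (fun k => mass (c k) (E : Set Z)) atTop (𝓝 0) := by
        simp only [mass_finset]
        have := tendsto_finsetSum E fun z _ => (hp z).abs
        simpa using this
      have h3 : 0 < ρ / 3 := by positivity
      obtain ⟨k, hkA, hkE, hkT⟩ := (hA.and_eventually
        ((hE.eventually (gt_mem_nhds h3)).and (hT.eventually (gt_mem_nhds h3)))).exists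
      obtain ⟨F, hF⟩ := exists_mass_compl_lt (hs k) h3
      refine ⟨(k, (F \ E).filter (· ∈ T)), ⟨hkA, fun z hz => ?_, ?_⟩, fun x hx => ?_⟩
      · simp at hz; exact hz.2
      · refine lt_of_le_of_lt (mass_mono (hs k) (T := (F : Set Z)ᶜ ∪ (E ∪ Tᶜ)) ?_) ?_
        · intro z hz
          simp only [Finset.coe_filter, Finset.mem_sdiff, mem_compl_iff, mem_ofPred_eq,
            mem_union, Finset.mem_coe] at hz ⊢
          tauto
        · have h1 := mass_union_le (hs k) (F : Set Z)ᶜ (E ∪ Tᶜ)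
          have h2 := mass_union_le (hs k) (E : Set Z) Tᶜ
          linarith
      · rw [Finset.disjoint_left]
        intro z hz hz'
        simp only [Finset.mem_filter, Finset.mem_sdiff] at hz'
        exact hz'.1.2 (Finset.mem_biUnion.2 ⟨x, hx, hz⟩))
  exact ⟨fun a => (f a).1, fun a => (f a).2, fun a => (hf a).1, fun a => (hf a).2.1,
    fun a => (hf a).2.2, hf'⟩

/-- A single hump: an admissible set which captures almost all the mass of one term, a part of it
on which this term is large, such that the set is small for almost all terms. -/
theorem exists_hump (hu : Function.Injective u) (hs : ∀ k, Summable (c k))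
    (hb : ∀ k, ∑' z, |c k z| ≤ 1) (hp : ∀ z, Tendsto (fun k => c k z) atTop (𝓝 0))
    (hsub : ∀ i G G', Adm i G → G' ⊆ G → Adm i G')
    (hT : ∀ i, Tendsto (fun k => mass (c k) (T i)ᶜ) atTop (𝓝 0))
    (hAdm : ∀ i (F : Finset Z), (F : Set Z) ⊆ T i → ∃ G, Adm i G ∧ ∀ z ∈ F, G ∈ u z)
    {ε : ℝ} (hε : 0 < ε) (𝒰 : Ultrafilter ℕ) {A : Set ℕ} (hA : ∃ᶠ k in atTop, k ∈ A)
    (hAε : ∀ k ∈ A, ε ≤ ∑' z, |c k z|) (i : ℕ) {δ : ℝ} (hδ : 0 < δ) :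
    ∃ k ∈ A, ∃ G V : Set Y, V ⊆ G ∧ Adm i G ∧ mass (c k) {z | G ∉ u z} ≤ ε / 16 ∧
      ε / 4 ≤ |∑' z, {z | V ∈ u z}.indicator (c k) z| ∧
      ∀ᶠ j in (𝒰 : Filter ℕ), mass (c j) {z | G ∈ u z} ≤ δ := by
  classical
  obtain ⟨k, F, hkA, hFT, hFρ, hdis⟩ := exists_disjoint_finsets hs hp (hT i)
    (show 0 < ε / 16 by positivity) hA
  obtain ⟨N, hN⟩ := exists_nat_gt (1 / δ)
  have hN0 : (0 : ℝ) < N := lt_trans (by positivity) hN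
  obtain ⟨B, hB, hBd⟩ := exists_pairwiseDisjoint_mem
    (((Finset.range N).biUnion F).image u)
  choose G₀ hG₀ hG₀F using fun a => hAdm i (F a) (hFT a)
  let G : ℕ → Set Y := fun a => G₀ a ∩ ⋃ z ∈ F a, B (u z)
  have hG : ∀ a, ∀ z ∈ F a, G a ∈ u z := fun a z hz =>
    inter_mem (hG₀F a z hz) (mem_of_superset (hB (u z)) (subset_biUnion_of_mem (u := fun z => B (u z)) hz))
  have hGd : ∀ a < N, ∀ b < N, a ≠ b → Disjoint (G a) (G b) := by
    intro a ha b hb hab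
    refine Disjoint.mono inter_subset_right inter_subset_right ?_
    simp only [disjoint_iUnion_left, disjoint_iUnion_right]
    intro z hz w hw
    have key : Disjoint (F a) (F b) := by
      rcases hab.lt_or_gt with h | h
      · exact hdis _ _ h
      · exact (hdis _ _ h).symm
    have hmem : ∀ d < N, ∀ z ∈ F d, u z ∈ ((Finset.range N).biUnion F).image u := fun d hd z hz =>
      Finset.mem_image_of_mem _ (Finset.mem_biUnion.2 ⟨d, Finset.mem_range.2 hd, hz⟩)
    refine hBd (hmem a ha w hw) (hmem b hb z hz) fun h => ?_
    rw [hu h] at hw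
    exact Finset.disjoint_left.1 key hw hz
  have hev : ∃ a ∈ Finset.range N, ∀ᶠ j in (𝒰 : Filter ℕ), mass (c j) {z | G a ∈ u z} ≤ δ := by
    by_contra! h1
    rw [← eventually_all_finset] at h1
    obtain ⟨j, hj⟩ := h1.exists
    have h2 := sum_mass_le (hs j) (Finset.range N) (fun a => {z | G a ∈ u z}) (by
      intro a ha b hb hab
      rw [Function.onFun, Set.disjoint_left]
      intro z hz hz'
      have := inter_mem (f := (u z : Filter Y)) hz hz'
      rw [(hGd a (by simpa using ha) b (by simpa using hb) hab).inter_eq] at this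
      exact (u z).empty_notMem this)
    have h3 := Finset.sum_le_sum fun a ha => (hj a ha).le
    simp only [Finset.sum_const, Finset.card_range, nsmul_eq_mul] at h3
    have h4 : 1 < N * δ := by rwa [div_lt_iff₀ hδ] at hN
    linarith [hb j]
  obtain ⟨a, -, ha⟩ := hev
  obtain ⟨V₀, hV₀⟩ : ∃ V₀ : Set Y, ∀ z ∈ F a, V₀ ∈ u z ↔ 0 < c (k a) z := by
    obtain ⟨B, hB, hBd⟩ := exists_pairwiseDisjoint_mem ((F a).image u)
    refine ⟨⋃ z ∈ (F a).filter (fun z => 0 < c (k a) z), B (u z), fun z hz => ⟨fun h => ?_, fun h => ?_⟩⟩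
    · by_contra hneg
      have := inter_mem (f := (u z : Filter Y)) h (hB (u z))
      have he : (⋃ z ∈ (F a).filter (fun z => 0 < c (k a) z), B (u z)) ∩ B (u z) = ∅ := by
        rw [← Set.disjoint_iff_inter_eq_empty]
        simp only [disjoint_iUnion_left]
        intro w hw
        rw [Finset.mem_filter] at hw
        refine hBd (by simpa using ⟨w, hw.1, rfl⟩) (by simpa using ⟨z, hz, rfl⟩) fun h => hneg ?_
        rw [← hu h]; exact hw.2
      rw [he] at this
      exact (u z).empty_notMem this
    · exact mem_of_superset (hB (u z)) (subset_biUnion_of_mem (u := fun z => B (u z))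
        (show z ∈ (F a).filter (fun z => 0 < c (k a) z) from Finset.mem_filter.2 ⟨hz, h⟩))
  have hGm : mass (c (k a)) {z | G a ∉ u z} ≤ ε / 16 :=
    (mass_mono (hs _) fun z (hz : G a ∉ u z) hzF => hz (hG a z hzF)).trans (hFρ a).le
  have hAG : Adm i (G a) := hsub _ _ _ (hG₀ a) inter_subset_left
  have hlarge : ε / 2 ≤ ∑' z, {z | G a ∩ V₀ ∈ u z}.indicator (c (k a)) z -
      ∑' z, {z | G a \ V₀ ∈ u z}.indicator (c (k a)) z := by
    rw [← ((hs _).indicator _).tsum_sub ((hs _).indicator _)]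
    have h1 : ∑' z, |c (k a) z| ≤ ∑' z, (({z | G a ∩ V₀ ∈ u z}.indicator (c (k a)) z -
      {z | G a \ V₀ ∈ u z}.indicator (c (k a)) z) +
        3 * (F a : Set Z)ᶜ.indicator (fun z => |c (k a) z|) z) := by
      refine (hs _).abs.tsum_le_tsum (fun z => ?_) ((((hs _).indicator _).sub
        ((hs _).indicator _)).add ((summable_mass (hs _) _).mul_left 3))
      by_cases hz : z ∈ F a
      · have hGz := hG a z hz
        by_cases hc : 0 < c (k a) z
        · have h1 : G a ∩ V₀ ∈ u z := inter_mem hGz ((hV₀ z hz).2 hc)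
          have h2 : G a \ V₀ ∉ u z := fun h => by
            have := inter_mem (f := (u z : Filter Y)) h h1
            rw [show G a \ V₀ ∩ (G a ∩ V₀) = ∅ by ext; simp; tauto] at this
            exact (u z).empty_notMem this
          simp [h1, h2, hz, abs_of_pos hc]
        · have h1 : V₀ ∉ u z := fun h => hc ((hV₀ z hz).1 h)
          have h2 : G a ∩ V₀ ∉ u z := fun h => h1 (mem_of_superset h inter_subset_right)
          have h3 : G a \ V₀ ∈ u z := inter_mem hGz (Ultrafilter.compl_mem_iff_notMem.2 h1)
          simp [h2, h3, hz, abs_of_nonpos (not_lt.1 hc)]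
      · have e1 := le_abs_self (c (k a) z)
        have e2 := neg_abs_le (c (k a) z)
        by_cases h1 : G a ∩ V₀ ∈ u z <;> by_cases h2 : G a \ V₀ ∈ u z <;>
          simp only [indicator, mem_ofPred_eq, h1, h2, if_true, if_false, mem_compl_iff,
            Finset.mem_coe, hz, not_false_eq_true] <;> linarith
    rw [Summable.tsum_add (((hs _).indicator _).sub ((hs _).indicator _))
      ((summable_mass (hs _) _).mul_left 3), tsum_mul_left] at h1
    have h2 := hFρ a
    have h3 := hAε _ (hkA a)
    unfold mass at h2
    linarith
  rcases le_or_gt (ε / 4) |∑' z, {z | G a ∩ V₀ ∈ u z}.indicator (c (k a)) z| with h | h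
  · exact ⟨k a, hkA a, G a, G a ∩ V₀, inter_subset_left, hAG, hGm, h, ha⟩
  · refine ⟨k a, hkA a, G a, G a \ V₀, sdiff_subset, hAG, hGm, ?_, ha⟩
    have h1 := abs_lt.1 h
    rw [le_abs]
    right
    linarith

/-- A bounded, pointwise null sequence in `ℓ₁`, whose sums over the sets of ultrafilters
`{z | B ∈ u z}` tend to zero for sufficiently many `B`, is norm null. -/
theorem tendsto_tsum_abs_zero (hu : Function.Injective u) (hs : ∀ k, Summable (c k))
    (hb : ∀ k, ∑' z, |c k z| ≤ 1) (hp : ∀ z, Tendsto (fun k => c k z) atTop (𝓝 0))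
    (hmono : ∀ i j G, i ≤ j → Adm j G → Adm i G)
    (hsub : ∀ i G G', Adm i G → G' ⊆ G → Adm i G')
    (hT : ∀ i, Tendsto (fun k => mass (c k) (T i)ᶜ) atTop (𝓝 0))
    (hAdm : ∀ i (F : Finset Z), (F : Set Z) ⊆ T i → ∃ G, Adm i G ∧ ∀ z ∈ F, G ∈ u z)
    (hconv : ∀ G : ℕ → Set Y, (∀ i, Adm i (G i)) → ∀ B ⊆ ⋃ i, G i,
      Tendsto (fun k => ∑' z, {z | B ∈ u z}.indicator (c k) z) atTop (𝓝 0)) :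
    Tendsto (fun k => ∑' z, |c k z|) atTop (𝓝 0) := by
  by_contra hcon
  obtain ⟨ε, hε, hfr⟩ : ∃ ε > 0, ∃ᶠ k in atTop, ε ≤ ∑' z, |c k z| := by
    by_contra! h
    refine hcon (Metric.tendsto_atTop'.2 fun ε hε => ?_)
    obtain ⟨N, hN⟩ := eventually_atTop.1 (h ε hε)
    refine ⟨N, fun n hn => ?_⟩
    rw [Real.dist_eq, sub_zero, abs_of_nonneg (tsum_nonneg fun _ => abs_nonneg _)]
    exact hN n hn.le
  let A : Set ℕ := {k | ε ≤ ∑' z, |c k z|}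
  have hne : (atTop ⊓ 𝓟 A).NeBot := frequently_mem_iff_neBot.1 hfr
  let 𝒰 : Ultrafilter ℕ := Ultrafilter.of (atTop ⊓ 𝓟 A)
  have h𝒰 : (𝒰 : Filter ℕ) ≤ atTop ⊓ 𝓟 A := Ultrafilter.of_le _
  have h𝒰top : (𝒰 : Filter ℕ) ≤ atTop := h𝒰.trans inf_le_left
  have h𝒰A : A ∈ (𝒰 : Filter ℕ) := h𝒰 (mem_inf_of_right (mem_principal_self A))
  let δ : ℕ → ℝ := fun i => ε / 16 * (1 / 2) ^ (i + 1)
  have hδ : ∀ i, 0 < δ i := fun i => by positivity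
  have hδanti : Antitone δ := fun i j hij => by
    refine mul_le_mul_of_nonneg_left ?_ (by positivity)
    exact pow_le_pow_of_le_one (by norm_num) (by norm_num) (by omega)
  have hδsum : ∀ n, ∑ i ∈ Finset.range n, δ i ≤ ε / 16 := fun n => by
    have : ∑ i ∈ Finset.range n, δ i = ε / 16 * (1 - (1 / 2) ^ n) := by
      induction n with
      | zero => simp
      | succ n ih => rw [Finset.sum_range_succ, ih]; simp only [δ]; ring
    rw [this]
    have : (0 : ℝ) < (1 / 2) ^ n := by positivity
    nlinarith
  obtain ⟨f, hf, hf'⟩ := exists_seq_of_forall_finset_exists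
    (α := ℕ × ℕ × Set Y × Set Y)
    (fun x => x.2.2.2 ⊆ x.2.2.1 ∧ Adm x.1 x.2.2.1 ∧ mass (c x.2.1) {z | x.2.2.1 ∉ u z} ≤ ε / 16 ∧
      ε / 4 ≤ |∑' z, {z | x.2.2.2 ∈ u z}.indicator (c x.2.1) z| ∧
      ∀ᶠ j in (𝒰 : Filter ℕ), mass (c j) {z | x.2.2.1 ∈ u z} ≤ δ x.1)
    (fun x y => x.1 < y.1 ∧ x.2.1 < y.2.1 ∧ mass (c y.2.1) {z | x.2.2.1 ∈ u z} ≤ δ x.1)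
    (fun s hsP => by
      let i := (s.sup Prod.fst) + 1
      have h1 : ∀ᶠ j in (𝒰 : Filter ℕ), ∀ x ∈ s, mass (c j) {z | x.2.2.1 ∈ u z} ≤ δ x.1 := by
        rw [eventually_all_finset]
        exact fun x hx => (hsP x hx).2.2.2.2
      have h2 : ∀ᶠ j in (𝒰 : Filter ℕ), ∀ x ∈ s, x.2.1 < j := by
        rw [eventually_all_finset]
        exact fun x hx => h𝒰top (eventually_gt_atTop _)
      have h3 := ((h1.and h2).and h𝒰A).frequently.filter_mono h𝒰top
      obtain ⟨k, ⟨⟨hk1, hk2⟩, hkA⟩, G, V, hVG, hG, hm, hl, he⟩ :=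
        exists_hump hu hs hb hp hsub hT hAdm hε 𝒰 (A := {j | ((∀ x ∈ s,
          mass (c j) {z | x.2.2.1 ∈ u z} ≤ δ x.1) ∧ (∀ x ∈ s, x.2.1 < j)) ∧ j ∈ A}) h3
          (fun k hk => hk.2) i (hδ i)
      exact ⟨(i, k, G, V), ⟨hVG, hG, hm, hl, he⟩, fun x hx =>
        ⟨Nat.lt_succ_of_le (Finset.le_sup (f := Prod.fst) hx), hk2 x hx, hk1 x hx⟩⟩)
  have hi : ∀ n, n ≤ (f n).1 := fun n =>
    (strictMono_nat_of_lt_succ fun n => (hf' n _ n.lt_succ_self).1).le_apply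
  have hk : StrictMono fun n => (f n).2.1 := fun m n h => (hf' m n h).2.1
  let G : ℕ → Set Y := fun n => (f n).2.2.1
  let V : ℕ → Set Y := fun n => (f n).2.2.2
  let E : ℕ → Set Y := fun n => ⋃ i ∈ Finset.range n, G i
  let B : Set Y := ⋃ n, V n \ E n
  have hB := hconv G (fun n => hmono _ _ _ (hi n) (hf n).2.1) B
    (iUnion_mono fun n => sdiff_subset.trans (hf n).1)
  have hcomp := hB.comp hk.tendsto_atTop
  have hlow : ∀ n, ε / 8 ≤ |∑' z, {z | B ∈ u z}.indicator (c (f n).2.1) z| := by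
    intro n
    have h1 : |∑' z, {z | B ∈ u z}.indicator (c (f n).2.1) z -
        ∑' z, {z | V n ∈ u z}.indicator (c (f n).2.1) z| ≤
        mass (c (f n).2.1) ({z | G n ∉ u z} ∪ ⋃ i ∈ Finset.range n, {z | G i ∈ u z}) := by
      refine abs_tsum_indicator_sub_le (hs _) fun z hz => ?_
      simp only [mem_union, mem_ofPred_eq, mem_iUnion, not_or, not_not, not_exists] at hz ⊢
      obtain ⟨hz1, hz2⟩ := hz
      have hE : (E n)ᶜ ∈ u z := by
        rw [Ultrafilter.compl_mem_iff_notMem]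
        intro h
        obtain ⟨i, hi, h⟩ := (Ultrafilter.finite_biUnion_mem_iff (Finset.range n).finite_toSet).1 h
        exact hz2 i hi h
      have hGE := inter_mem (f := (u z : Filter Y)) hz1 hE
      constructor
      · intro h
        refine mem_of_superset (inter_mem h hGE) ?_
        rintro y ⟨hyB, hyG, hyE⟩
        obtain ⟨m, hym, hymE⟩ := mem_iUnion.1 hyB
        have h1 : ¬ n < m := fun hnm => hymE (mem_biUnion (Finset.mem_range.2 hnm) hyG)
        have h2 : ¬ m < n := fun hmn =>
          hyE (mem_biUnion (Finset.mem_range.2 hmn) ((hf m).1 hym))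
        rwa [show n = m by omega]
      · intro h
        refine mem_of_superset (inter_mem h hGE) ?_
        rintro y ⟨hyV, -, hyE⟩
        exact mem_iUnion.2 ⟨n, hyV, hyE⟩
    have h2 := mass_union_le (hs (f n).2.1) {z | G n ∉ u z} (⋃ i ∈ Finset.range n, {z | G i ∈ u z})
    have h3 := mass_biUnion_le (hs (f n).2.1) (Finset.range n) (fun i => {z | G i ∈ u z})
    have h4 : ∑ i ∈ Finset.range n, mass (c (f n).2.1) {z | G i ∈ u z} ≤
        ∑ i ∈ Finset.range n, δ i := Finset.sum_le_sum fun i hi' =>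
      ((hf' i n (Finset.mem_range.1 hi')).2.2).trans (hδanti (hi i))
    have h5 := hδsum n
    have h6 := (hf n).2.2.1
    have h7 := (hf n).2.2.2.1
    have h8 := abs_sub_abs_le_abs_sub (∑' z, {z | V n ∈ u z}.indicator (c (f n).2.1) z)
      (∑' z, {z | B ∈ u z}.indicator (c (f n).2.1) z)
    rw [abs_sub_comm] at h8
    linarith
  have h := hcomp.abs
  rw [abs_zero] at h
  have := ge_of_tendsto' h hlow
  linarith

end GlidingHump

section Mean

/-- The limit of the arithmetic means of a sequence along a fixed free ultrafilter. -/
noncomputable def ultraMean (g : ℕ → ℝ) : ℝ :=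
  limUnder (hyperfilter ℕ : Filter ℕ) fun m => (∑ i ∈ Finset.range m, g i) / m

theorem tendsto_ultraMean {g : ℕ → ℝ} {C : ℝ} (hg : ∀ i, |g i| ≤ C) :
    Tendsto (fun m : ℕ => (∑ i ∈ Finset.range m, g i) / m) (hyperfilter ℕ : Filter ℕ)
      (𝓝 (ultraMean g)) := by
  have hC : 0 ≤ C := (abs_nonneg _).trans (hg 0)
  have h : ∀ m : ℕ, (∑ i ∈ Finset.range m, g i) / m ∈ Icc (-C) C := fun m => by
    rw [mem_Icc, ← abs_le, abs_div, Nat.abs_cast]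
    refine div_le_of_le_mul₀ (Nat.cast_nonneg _) hC ?_
    calc |∑ i ∈ Finset.range m, g i| ≤ ∑ i ∈ Finset.range m, |g i| :=
          Finset.abs_sum_le_sum_abs _ _
      _ ≤ ∑ i ∈ Finset.range m, C := Finset.sum_le_sum fun i _ => hg i
      _ = C * m := by simp [mul_comm]
  obtain ⟨x, -, hx⟩ := (isCompact_Icc (a := -C) (b := C)).ultrafilter_le_nhds
    ((hyperfilter ℕ).map fun m : ℕ => (∑ i ∈ Finset.range m, g i) / m)
    (le_principal_iff.2 (Ultrafilter.mem_map.2 (univ_mem' h)))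
  exact tendsto_nhds_limUnder ⟨x, hx⟩

theorem ultraMean_add {g h : ℕ → ℝ} {C D : ℝ} (hg : ∀ i, |g i| ≤ C) (hh : ∀ i, |h i| ≤ D) :
    ultraMean (fun i => g i + h i) = ultraMean g + ultraMean h := by
  refine tendsto_nhds_unique (tendsto_ultraMean (C := C + D)
    fun i => (abs_add_le _ _).trans (add_le_add (hg i) (hh i))) ?_
  refine ((tendsto_ultraMean hg).add (tendsto_ultraMean hh)).congr fun m => ?_
  rw [Finset.sum_add_distrib, add_div]

theorem ultraMean_const_mul {g : ℕ → ℝ} {C : ℝ} (hg : ∀ i, |g i| ≤ C) (a : ℝ) :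
    ultraMean (fun i => a * g i) = a * ultraMean g := by
  refine tendsto_nhds_unique (tendsto_ultraMean (C := |a| * C) fun i => ?_) ?_
  · rw [abs_mul]
    exact mul_le_mul_of_nonneg_left (hg i) (abs_nonneg _)
  · refine ((tendsto_ultraMean hg).const_mul a).congr fun m => ?_
    rw [← Finset.mul_sum, mul_div_assoc]

theorem ultraMean_mono {g h : ℕ → ℝ} {C D : ℝ} (hg : ∀ i, |g i| ≤ C) (hh : ∀ i, |h i| ≤ D)
    (hgh : ∀ i, g i ≤ h i) : ultraMean g ≤ ultraMean h :=
  le_of_tendsto_of_tendsto' (tendsto_ultraMean hg) (tendsto_ultraMean hh) fun m =>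
    div_le_div_of_nonneg_right (Finset.sum_le_sum fun i _ => hgh i) (Nat.cast_nonneg m)

theorem ultraMean_const (a : ℝ) : ultraMean (fun _ => a) = a := by
  refine tendsto_nhds_unique (tendsto_ultraMean (C := |a|) fun i => le_rfl) ?_
  have h : ∀ᶠ m : ℕ in (hyperfilter ℕ : Filter ℕ), 0 < m :=
    Nat.hyperfilter_le_atTop (eventually_gt_atTop 0)
  refine tendsto_const_nhds.congr' (h.mono fun m hm => ?_)
  simp only [Finset.sum_const, Finset.card_range, nsmul_eq_mul]
  have : (m : ℝ) ≠ 0 := by positivity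
  field_simp

end Mean

section Density

/-- The finitely additive density of the `n`-th section of a subset of `ℕ × ℕ`. -/
noncomputable def dens (n : ℕ) (B : Set (ℕ × ℕ)) : ℝ :=
  ultraMean fun i => B.indicator (fun _ => (1 : ℝ)) (n, i)

theorem abs_indicator_one_le {α : Type*} (B : Set α) (x : α) :
    |B.indicator (fun _ => (1 : ℝ)) x| ≤ 1 := by
  by_cases h : x ∈ B <;> simp [h]

theorem dens_mono (n : ℕ) {B B' : Set (ℕ × ℕ)} (h : B ⊆ B') : dens n B ≤ dens n B' :=
  ultraMean_mono (fun _ => abs_indicator_one_le _ _) (fun _ => abs_indicator_one_le _ _) fun _ =>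
    indicator_le_indicator_of_subset h (fun _ => zero_le_one) _

theorem dens_empty (n : ℕ) : dens n ∅ = 0 := by
  simpa [dens] using ultraMean_const 0

theorem dens_nonneg (n : ℕ) (B : Set (ℕ × ℕ)) : 0 ≤ dens n B :=
  (dens_empty n).symm.le.trans (dens_mono n (empty_subset B))

theorem dens_union_le (n : ℕ) (B B' : Set (ℕ × ℕ)) : dens n (B ∪ B') ≤ dens n B + dens n B' := by
  unfold dens
  rw [← ultraMean_add (fun _ => abs_indicator_one_le _ _) (fun _ => abs_indicator_one_le _ _)]
  refine ultraMean_mono (D := 2) (fun _ => abs_indicator_one_le _ _) (fun i => ?_) fun i => ?_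
  · refine (abs_add_le _ _).trans ?_
    have h1 := abs_indicator_one_le B (n, i)
    have h2 := abs_indicator_one_le B' (n, i)
    linarith
  · by_cases h1 : (n, i) ∈ B <;> by_cases h2 : (n, i) ∈ B' <;> simp [h1, h2]

theorem dens_biUnion_le {ι : Type*} (n : ℕ) (s : Finset ι) (B : ι → Set (ℕ × ℕ)) :
    dens n (⋃ i ∈ s, B i) ≤ ∑ i ∈ s, dens n (B i) := by
  classical
  induction s using Finset.induction_on with
  | empty => simp [dens_empty]
  | insert a s ha ih =>
    rw [Finset.sum_insert ha, Finset.set_biUnion_insert]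
    exact (dens_union_le _ _ _).trans (by gcongr)

theorem dens_eq_zero {n : ℕ} {B : Set (ℕ × ℕ)} (h : ∀ i, (n, i) ∉ B) : dens n B = 0 := by
  simpa [dens, h] using ultraMean_const 0

theorem dens_singleton (n : ℕ) (y : ℕ × ℕ) : dens n {y} = 0 := by
  refine tendsto_nhds_unique (tendsto_ultraMean fun _ => abs_indicator_one_le _ _) ?_
  refine Tendsto.mono_left ?_ Nat.hyperfilter_le_atTop
  refine squeeze_zero (fun m => ?_) (fun m => ?_) tendsto_one_div_atTop_nhds_zero_nat
  · exact div_nonneg (Finset.sum_nonneg fun i _ => indicator_nonneg (fun _ _ => zero_le_one) _)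
      (Nat.cast_nonneg _)
  · refine div_le_div_of_nonneg_right ?_ (Nat.cast_nonneg m)
    calc ∑ i ∈ Finset.range m, ({y} : Set (ℕ × ℕ)).indicator (fun _ => (1 : ℝ)) (n, i)
        ≤ ∑ i ∈ Finset.range m, if i = y.2 then (1 : ℝ) else 0 := by
          refine Finset.sum_le_sum fun i _ => ?_
          by_cases h : (n, i) = y
          · simp [← h]
          · rw [indicator_of_notMem (by simpa using h)]
            split_ifs <;> norm_num
      _ ≤ 1 := by
          rw [Finset.sum_ite_eq']
          split_ifs <;> norm_num

theorem dens_residue_le (n r s : ℕ) (hr : 0 < r) :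
    dens n {y | y.2 ≡ s [MOD r]} ≤ 1 / r := by
  have hlim : Tendsto (fun m : ℕ => (1 : ℝ) / r + 1 / m) (hyperfilter ℕ : Filter ℕ)
      (𝓝 (1 / r + 0)) :=
    (tendsto_const_nhds.add tendsto_one_div_atTop_nhds_zero_nat).mono_left
      Nat.hyperfilter_le_atTop
  rw [add_zero] at hlim
  have hpos : ∀ᶠ m : ℕ in (hyperfilter ℕ : Filter ℕ), 0 < m :=
    Nat.hyperfilter_le_atTop (eventually_gt_atTop 0)
  refine le_of_tendsto_of_tendsto (tendsto_ultraMean fun _ => abs_indicator_one_le _ _) hlim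
    (hpos.mono fun m hm => ?_)
  have h1 : ∑ i ∈ Finset.range m,
      {y : ℕ × ℕ | y.2 ≡ s [MOD r]}.indicator (fun _ => (1 : ℝ)) (n, i) =
      (m.count (· ≡ s [MOD r]) : ℕ) := by
    rw [Nat.count_eq_card_filter_range, Finset.card_filter, Nat.cast_sum]
    refine Finset.sum_congr rfl fun i _ => ?_
    simp [indicator]
  have h2 : m.count (· ≡ s [MOD r]) ≤ m / r + 1 := by
    rw [Nat.count_modEq_card _ hr]
    split_ifs <;> omega
  have h3 : ((m / r : ℕ) : ℝ) ≤ m / r := Nat.cast_div_le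
  have hm' : (0 : ℝ) < m := by exact_mod_cast hm
  have hr' : (0 : ℝ) < r := by exact_mod_cast hr
  change (∑ i ∈ Finset.range m,
      {y : ℕ × ℕ | y.2 ≡ s [MOD r]}.indicator (fun _ => (1 : ℝ)) (n, i)) / m ≤ _
  rw [h1, div_le_iff₀ hm']
  have h4 : ((m.count (· ≡ s [MOD r]) : ℕ) : ℝ) ≤ (m / r : ℕ) + 1 := by exact_mod_cast h2
  have h5 : (1 / (r : ℝ) + 1 / m) * m = m / r + 1 := by field_simp
  linarith

/-- The subsets of `ℕ × ℕ` the densities of whose sections tend to zero. -/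
def Small (B : Set (ℕ × ℕ)) : Prop := Tendsto (fun n => dens n B) atTop (𝓝 0)

theorem Small.mono {B B' : Set (ℕ × ℕ)} (hB : Small B) (h : B' ⊆ B) : Small B' :=
  squeeze_zero (fun n => dens_nonneg n _) (fun n => dens_mono n h) hB

theorem Small.union {B B' : Set (ℕ × ℕ)} (hB : Small B) (hB' : Small B') : Small (B ∪ B') :=
  squeeze_zero (fun n => dens_nonneg n _) (fun n => dens_union_le n B B')
    (by simpa using Tendsto.add hB hB')

theorem small_empty : Small ∅ := by
  simp [Small, dens_empty]

theorem small_biUnion {ι : Type*} {s : Finset ι} {B : ι → Set (ℕ × ℕ)}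
    (h : ∀ i ∈ s, Small (B i)) : Small (⋃ i ∈ s, B i) := by
  classical
  induction s using Finset.induction_on with
  | empty => simpa using small_empty
  | insert a s ha ih =>
    rw [Finset.set_biUnion_insert]
    exact (h a (Finset.mem_insert_self _ _)).union
      (ih fun i hi => h i (Finset.mem_insert_of_mem hi))

theorem small_singleton (y : ℕ × ℕ) : Small {y} := by
  simp [Small, dens_singleton]

/-- The `n`-th column of `ℕ × ℕ`. -/
def column (n : ℕ) : Set (ℕ × ℕ) := {y | y.1 = n}

theorem small_column (n : ℕ) : Small (column n) := by
  refine tendsto_const_nhds.congr' ((eventually_gt_atTop n).mono fun m hm => ?_)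
  exact (dens_eq_zero fun i h => hm.ne' h).symm

/-- Every ultrafilter containing a small set contains one all of whose sections have
small density. -/
theorem exists_small_dens_le {p : Ultrafilter (ℕ × ℕ)} {B : Set (ℕ × ℕ)} (hp : B ∈ p)
    (hB : Small B) {η : ℝ} (hη : 0 < η) :
    ∃ G ∈ p, Small G ∧ ∀ n, dens n G ≤ η := by
  obtain ⟨r, hr⟩ := exists_nat_one_div_lt hη
  have hcover : (⋃ s ∈ Finset.range (r + 1), {y : ℕ × ℕ | y.2 ≡ s [MOD (r + 1)]}) ∈ p := by
    refine mem_of_superset univ_mem fun y _ => ?_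
    refine mem_biUnion (x := y.2 % (r + 1)) ?_ ?_
    · exact Finset.mem_coe.2 (Finset.mem_range.2 (Nat.mod_lt _ r.succ_pos))
    · exact (Nat.mod_modEq _ _).symm
  obtain ⟨s, -, hs⟩ :=
    (Ultrafilter.finite_biUnion_mem_iff (Finset.range (r + 1)).finite_toSet).1 hcover
  refine ⟨B ∩ {y | y.2 ≡ s [MOD (r + 1)]}, inter_mem hp hs, hB.mono inter_subset_left, fun n => ?_⟩
  refine (dens_mono n inter_subset_right).trans ((dens_residue_le n (r + 1) s r.succ_pos).trans ?_)
  push_cast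
  exact hr.le

end Density

section Space

/-- The ultrafilters on `ℕ × ℕ` containing a small set. -/
def smallUltra : Set (Ultrafilter (ℕ × ℕ)) := {p | ∃ B ∈ p, Small B}

theorem isOpen_smallUltra : IsOpen smallUltra := by
  have : smallUltra = ⋃ B ∈ {B | Small B}, {p | B ∈ p} := by
    ext p
    simp [smallUltra, and_comm]
  rw [this]
  exact isOpen_biUnion fun B _ => ultrafilter_isOpen_basic B

instance : LocallyCompactSpace smallUltra := isOpen_smallUltra.locallyCompactSpace

/-- The one-point compactification of the space of ultrafilters containing a small set. -/
abbrev Space : Type := OnePoint smallUltra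

theorem isCompact_basic {B : Set (ℕ × ℕ)} (hB : Small B) :
    IsCompact {w : smallUltra | B ∈ w.1} := by
  rw [Subtype.isCompact_iff]
  have : Subtype.val '' {w : smallUltra | B ∈ w.1} = {p | B ∈ p} := by
    ext p
    simp only [mem_image, Subtype.exists, mem_ofPred_eq, exists_and_left, exists_prop,
      exists_eq_right_right]
    exact ⟨fun h => h.1, fun h => ⟨h, B, h, hB⟩⟩
  rw [this]
  exact (ultrafilter_isClosed_basic B).isCompact

theorem isOpen_basic (B : Set (ℕ × ℕ)) : IsOpen {w : smallUltra | B ∈ w.1} :=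
  (ultrafilter_isOpen_basic B).preimage continuous_subtype_val

/-- The subset of the space determined by a subset of `ℕ × ℕ`. -/
def basic (B : Set (ℕ × ℕ)) : Set Space := OnePoint.some '' {w : smallUltra | B ∈ w.1}

theorem isClopen_basic {B : Set (ℕ × ℕ)} (hB : Small B) : IsClopen (basic B) :=
  ⟨((isCompact_basic hB).image OnePoint.continuous_coe).isClosed,
    OnePoint.isOpenMap_coe _ (isOpen_basic B)⟩

theorem coe_mem_basic {B : Set (ℕ × ℕ)} {w : smallUltra} :
    (w : Space) ∈ basic B ↔ B ∈ w.1 := by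
  simp [basic]

theorem infty_notMem_basic {B : Set (ℕ × ℕ)} : (OnePoint.infty : Space) ∉ basic B := by
  simp [basic]

theorem basic_mono {B B' : Set (ℕ × ℕ)} (h : B ⊆ B') : basic B ⊆ basic B' :=
  image_mono fun w hw => mem_of_superset (f := (w.1 : Filter (ℕ × ℕ))) hw h

/-- The indicator function of a basic clopen set, as a continuous function. -/
noncomputable def basicInd {B : Set (ℕ × ℕ)} (hB : Small B) : C(Space, ℝ) where
  toFun := (basic B).indicator fun _ => 1
  continuous_toFun := (isClopen_basic hB).continuous_indicator continuous_const

/-- The isolated point given by an element of `ℕ × ℕ`. -/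
noncomputable def point (y : ℕ × ℕ) : Space :=
  OnePoint.some ⟨pure y, {y}, Ultrafilter.mem_pure.2 rfl, small_singleton y⟩

theorem point_mem_basic {B : Set (ℕ × ℕ)} {y : ℕ × ℕ} : point y ∈ basic B ↔ y ∈ B :=
  coe_mem_basic.trans Ultrafilter.mem_pure

theorem point_injective : Function.Injective point := fun y y' h => by
  have h1 : point y' ∈ basic {y} := h ▸ point_mem_basic.2 rfl
  exact (point_mem_basic.1 h1).symm

instance : Infinite Space := Infinite.of_injective point point_injective

instance : TopologicalSpace.SeparableSpace Space := by
  refine ⟨insert OnePoint.infty (range point), (countable_range _).insert _, fun x => ?_⟩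
  rw [mem_closure_iff]
  intro U hU hx
  induction x using OnePoint.rec with
  | infty => exact ⟨_, hx, mem_insert _ _⟩
  | coe w =>
    obtain ⟨V, hV, hVU⟩ := isOpen_induced_iff.1 (hU.preimage OnePoint.continuous_coe)
    have hwV : w.1 ∈ V := by
      change w ∈ Subtype.val ⁻¹' V
      rw [hVU]
      exact hx
    have h1 := (Ultrafilter.tendsto_pure_self w.1) (hV.mem_nhds hwV)
    obtain ⟨y, hy⟩ := w.1.nonempty_of_mem h1
    refine ⟨point y, ?_, mem_insert_of_mem _ (mem_range_self y)⟩
    have h2 : (⟨pure y, {y}, Ultrafilter.mem_pure.2 rfl, small_singleton y⟩ : smallUltra) ∈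
      Subtype.val ⁻¹' V := hy
    rw [hVU] at h2
    exact h2

/-- A neighbourhood of infinity contains all points outside a small set. -/
theorem exists_small_of_isClosed {C : Set Space} (hC : IsClosed C) (h : OnePoint.infty ∉ C) :
    ∃ B, Small B ∧ C ⊆ basic B := by
  refine hC.isCompact.induction_on (p := fun s => ∃ B, Small B ∧ s ⊆ basic B)
    ⟨∅, small_empty, empty_subset _⟩ (fun s t hst ⟨B, hB, ht⟩ => ⟨B, hB, hst.trans ht⟩)
    (fun s t ⟨B, hB, hs⟩ ⟨B', hB', ht⟩ => ⟨B ∪ B', hB.union hB', union_subset ?_ ?_⟩)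
    fun x hx => ?_
  · exact hs.trans (basic_mono subset_union_left)
  · exact ht.trans (basic_mono subset_union_right)
  · induction x using OnePoint.rec with
    | infty => exact absurd hx h
    | coe w =>
      obtain ⟨B, hBw, hB⟩ := w.2
      exact ⟨basic B, mem_nhdsWithin_of_mem_nhds
        ((isClopen_basic hB).isOpen.mem_nhds (coe_mem_basic.2 hBw)), B, hB, Subset.rfl⟩

instance : MeasurableSpace Space := borel _

instance : BorelSpace Space := ⟨rfl⟩

end Space

section Reduction

theorem tsum_onePoint {α : Type*} {g : OnePoint α → ℝ} (hg : Summable g) :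
    ∑' x, g x = g OnePoint.infty + ∑' z : α, g z := by
  classical
  have h1 := hg.tsum_eq_add_tsum_ite OnePoint.infty
  rw [h1]
  congr 1
  rw [← (OnePoint.coe_injective (X := α)).tsum_eq]
  · simp
  · intro x hx
    induction x using OnePoint.rec with
    | infty => simp at hx
    | coe w => exact mem_range_self w

theorem summable_onePoint_coe {α : Type*} {g : OnePoint α → ℝ} (hg : Summable g) :
    Summable fun z : α => g z :=
  hg.comp_injective OnePoint.coe_injective

theorem tendsto_mass_zero {d : ℕ → Space → ℝ} (hs : ∀ k, Summable (d k))
    (hb : ∀ k, ∑' x, |d k x| ≤ 1) (hp : ∀ x, Tendsto (d · x) atTop (𝓝 0))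
    (hf : ∀ f : C(Space, ℝ), Tendsto (fun k => ∑' x, d k x * f x) atTop (𝓝 0)) :
    Tendsto (fun k => ∑' x, |d k x|) atTop (𝓝 0) := by
  have hsc : ∀ k, Summable fun w : smallUltra => d k w := fun k => summable_onePoint_coe (hs k)
  have hbc : ∀ k, ∑' w : smallUltra, |d k w| ≤ 1 := fun k => by
    have := tsum_onePoint (hs k).abs
    have h2 := abs_nonneg (d k OnePoint.infty)
    linarith [hb k]
  have hind : ∀ B, Small B → Tendsto (fun k => ∑' w : smallUltra,
      {w : smallUltra | B ∈ w.1}.indicator (fun w => d k w) w) atTop (𝓝 0) := fun B hB => by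
    refine (hf (basicInd hB)).congr fun k => ?_
    have hval : ∀ x, d k x * basicInd hB x = (basic B).indicator (d k) x := fun x => by
      by_cases h : x ∈ basic B <;> simp [basicInd, h]
    simp only [hval]
    rw [tsum_onePoint ((hs k).indicator _), indicator_of_notMem infty_notMem_basic, zero_add]
    refine tsum_congr fun w => ?_
    by_cases h : B ∈ w.1
    · simp [h, coe_mem_basic]
    · simp [h, coe_mem_basic]
  have hcol : ∀ n, Tendsto (fun k => mass (fun w : smallUltra => d k w)
      {w : smallUltra | column n ∈ w.1}) atTop (𝓝 0) := fun n => by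
    have key := tendsto_tsum_abs_zero (Y := ℕ × ℕ) (Z := smallUltra) (u := Subtype.val)
      (c := fun k => {w : smallUltra | column n ∈ w.1}.indicator fun w => d k w)
      (Adm := fun _ G => G ⊆ column n) (T := fun _ => {w : smallUltra | column n ∈ w.1})
      Subtype.val_injective (fun k => (hsc k).indicator _) (fun k => ?_) (fun w => ?_)
      (fun _ _ _ _ h => h) (fun _ _ _ h h' => h'.trans h) (fun i => ?_) (fun i F hF => ?_)
      (fun G hG B hB => ?_)
    · refine key.congr fun k => tsum_congr fun w => ?_
      by_cases h : column n ∈ w.1 <;> simp [h]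
    · refine le_trans ?_ (hbc k)
      refine ((hsc k).indicator _).abs.tsum_le_tsum (fun w => ?_) (hsc k).abs
      by_cases h : column n ∈ w.1 <;> simp [h]
    · by_cases h : column n ∈ w.1
      · simpa [h] using hp w
      · simp [h]
    · refine tendsto_const_nhds.congr fun k => ?_
      refine Eq.trans tsum_zero.symm (tsum_congr fun w => ?_)
      by_cases h : column n ∈ w.1 <;> simp [h]
    · exact ⟨column n, Subset.rfl, fun w hw => hF hw⟩
    · have hBc : B ⊆ column n := hB.trans (iUnion_subset hG)
      refine (hind B ((small_column n).mono hBc)).congr fun k => tsum_congr fun w => ?_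
      by_cases h : B ∈ w.1
      · have : column n ∈ w.1 := mem_of_superset h hBc
        simp [h, this]
      · simp [h]
  have hmain := tendsto_tsum_abs_zero (Y := ℕ × ℕ) (Z := smallUltra) (u := Subtype.val)
      (c := fun k w => d k w)
      (Adm := fun i G => Small G ∧ (∀ n, dens n G ≤ (1 / 2) ^ i) ∧ ∀ n < i, Disjoint G (column n))
      (T := fun i => {w : smallUltra | ∀ n < i, column n ∉ w.1})
      Subtype.val_injective hsc hbc (fun w => hp w)
      (fun i j G hij hG => ⟨hG.1, fun n => (hG.2.1 n).trans
        (pow_le_pow_of_le_one (by norm_num) (by norm_num) hij), fun n hn => hG.2.2 n (by omega)⟩)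
      (fun i G G' hG h => ⟨hG.1.mono h, fun n => (dens_mono n h).trans (hG.2.1 n),
        fun n hn => (hG.2.2 n hn).mono_left h⟩)
      (fun i => ?_) (fun i F hF => ?_) (fun G hG B hB => hind B ?_)
  · have := (hp OnePoint.infty).abs.add hmain
    simp only [abs_zero, add_zero] at this
    exact this.congr fun k => (tsum_onePoint (hs k).abs).symm
  · have hsub : {w : smallUltra | ∀ n < i, column n ∉ w.1}ᶜ ⊆
        ⋃ n ∈ Finset.range i, {w : smallUltra | column n ∈ w.1} := fun w hw => by
      simpa using hw
    refine squeeze_zero (fun k => mass_nonneg _ _) (fun k => (mass_mono (hsc k) hsub).trans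
      (mass_biUnion_le (hsc k) _ _)) ?_
    simpa using tendsto_finsetSum (Finset.range i) fun n _ => hcol n
  · have hη : (0 : ℝ) < (1 / 2) ^ i / (F.card + 1) := by positivity
    have hex : ∀ w : smallUltra, ∃ G ∈ w.1, Small G ∧
        ∀ n, dens n G ≤ (1 / 2) ^ i / (F.card + 1) := fun w => by
      obtain ⟨B, hBw, hB⟩ := w.2
      exact exists_small_dens_le hBw hB hη
    choose G hGw hGs hGd using hex
    refine ⟨(⋃ w ∈ F, G w) \ ⋃ n ∈ Finset.range i, column n, ⟨?_, fun n => ?_, fun n hn => ?_⟩,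
      fun w hw => ?_⟩
    · exact (small_biUnion fun w _ => hGs w).mono sdiff_subset
    · refine (dens_mono n sdiff_subset).trans ((dens_biUnion_le n F G).trans ?_)
      refine (Finset.sum_le_sum fun w _ => hGd w n).trans ?_
      rw [Finset.sum_const, nsmul_eq_mul, mul_div_assoc', div_le_iff₀ (by positivity), mul_comm]
      exact mul_le_mul_of_nonneg_left (by linarith) (by positivity)
    · refine disjoint_sdiff_left.mono_right ?_
      exact subset_biUnion_of_mem (u := fun n => column n) (Finset.mem_coe.2 (Finset.mem_range.2 hn))
    · have h1 : (⋃ w ∈ F, G w) ∈ w.1 :=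
        mem_of_superset (hGw w) (subset_biUnion_of_mem (u := fun w => G w) hw)
      have h2 : (⋂ n ∈ Finset.range i, (column n)ᶜ) ∈ (w.1 : Filter (ℕ × ℕ)) := by
        rw [Filter.biInter_finset_mem]
        exact fun n hn => Ultrafilter.compl_mem_iff_notMem.2 (hF hw n (Finset.mem_range.1 hn))
      refine mem_of_superset (inter_mem h1 h2) ?_
      rintro y ⟨hy1, hy2⟩
      exact ⟨hy1, by simpa using hy2⟩
  · refine Small.mono (B := ⋃ i, G i) ?_ hB
    have hle : ∀ n, dens n (⋃ i, G i) ≤ ∑' i, dens n (G i) := fun n => by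
      have h0 : ∀ i ∉ Finset.range (n + 1), dens n (G i) = 0 := fun i hi => by
        refine dens_eq_zero fun j hj => ?_
        have := (hG i).2.2 n (by simpa using hi)
        exact disjoint_left.1 this hj rfl
      rw [tsum_eq_sum h0]
      refine le_trans (b := dens n (⋃ i ∈ Finset.range (n + 1), G i) +
        dens n ((⋃ i, G i) \ ⋃ i ∈ Finset.range (n + 1), G i)) ?_ ?_
      · refine le_trans (dens_mono n ?_) (dens_union_le n _ _)
        rw [union_sdiff_self]
        exact subset_union_right
      · rw [dens_eq_zero (B := (⋃ i, G i) \ ⋃ i ∈ Finset.range (n + 1), G i), add_zero]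
        · exact dens_biUnion_le n _ _
        · rintro j ⟨hj1, hj2⟩
          obtain ⟨i, hi⟩ := mem_iUnion.1 hj1
          by_cases hin : i ∈ Finset.range (n + 1)
          · exact hj2 (mem_biUnion (Finset.mem_coe.2 hin) hi)
          · exact disjoint_left.1 ((hG i).2.2 n (by simpa using hin)) hi rfl
    refine squeeze_zero (fun n => dens_nonneg n _) hle ?_
    have := tendsto_tsum_of_dominated_convergence (𝓕 := atTop) (f := fun n i => dens n (G i))
      (g := fun _ => (0 : ℝ)) (bound := fun i : ℕ => ((1 : ℝ) / 2) ^ i)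
      (summable_geometric_of_lt_one (by norm_num) (by norm_num)) (fun i => (hG i).1)
      (Eventually.of_forall fun n i => ?_)
    · simpa using this
    · rw [Real.norm_of_nonneg (dens_nonneg n _)]
      exact (hG i).2.1 n

end Reduction

section EllOne

theorem summable_abs_lp {L : Type*} (a : lp (fun _ : L => ℝ) 1) : Summable fun x => |a x| := by
  simpa using (lp.memℓp a).summable (by simp)

theorem norm_lp_eq {L : Type*} (a : lp (fun _ : L => ℝ) 1) : ‖a‖ = ∑' x, |a x| := by
  simpa using lp.norm_eq_tsum_rpow (p := 1) (by simp) a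

theorem exists_subseq_pointwise {L : Type*} {e : ℕ → lp (fun _ : L => ℝ) 1} (he : ∀ k, ‖e k‖ ≤ 1) :
    ∃ ψ : ℕ → ℕ, StrictMono ψ ∧ ∀ x, ∃ l, Tendsto (fun k => e (ψ k) x) atTop (𝓝 l) := by
  have hS : (⋃ k, Function.support (e k)).Countable :=
    countable_iUnion fun k => (summable_abs_lp (e k)).of_abs.countable_support
  have := hS.to_subtype
  have hK : IsCompact (univ.pi fun _ : ⋃ k, Function.support (e k) => Icc (-1 : ℝ) 1) :=
    isCompact_univ_pi fun _ => isCompact_Icc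
  obtain ⟨l, -, ψ, hψ, hl⟩ := hK.tendsto_subseq (x := fun k (x : ⋃ k, Function.support (e k)) => e k x)
      fun k x _ => by
    rw [mem_Icc, ← abs_le]
    exact (lp.norm_apply_le_norm (by simp) (e k) x).trans (he k)
  refine ⟨ψ, hψ, fun x => ?_⟩
  by_cases hx : x ∈ ⋃ k, Function.support (e k)
  · exact ⟨l ⟨x, hx⟩, (tendsto_pi_nhds.1 hl) ⟨x, hx⟩⟩
  · refine ⟨0, tendsto_const_nhds.congr fun k => ?_⟩
    by_contra h
    exact hx (mem_iUnion.2 ⟨ψ k, Ne.symm h⟩)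

variable {L : Type*} [TopologicalSpace L] [CompactSpace L]

theorem abs_mul_apply_le (c : ℝ) (f : C(L, ℝ)) (x : L) : |c * f x| ≤ |c| * ‖f‖ := by
  rw [abs_mul]
  exact mul_le_mul_of_nonneg_left (f.norm_coe_le_norm x) (abs_nonneg _)

theorem summable_mul_apply {c : L → ℝ} (hc : Summable fun x => |c x|) (f : C(L, ℝ)) :
    Summable fun x => c x * f x :=
  Summable.of_norm_bounded (hc.mul_right ‖f‖) fun x => abs_mul_apply_le _ f x

/-- Integration of a continuous function against a summable family, as a functional on `ℓ¹`. -/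
noncomputable def pairing (f : C(L, ℝ)) : lp (fun _ : L => ℝ) 1 →L[ℝ] ℝ :=
  LinearMap.mkContinuous
    { toFun := fun a => ∑' x, a x * f x
      map_add' := fun a b => by
        rw [← (summable_mul_apply (summable_abs_lp a) f).tsum_add
          (summable_mul_apply (summable_abs_lp b) f)]
        exact tsum_congr fun x => by simp [add_mul]
      map_smul' := fun r a => by
        rw [RingHom.id_apply, smul_eq_mul, ← tsum_mul_left]
        exact tsum_congr fun x => by simp [mul_assoc] } ‖f‖ fun a => by
    rw [norm_lp_eq, ← tsum_mul_left]
    refine tsum_of_norm_bounded ((summable_abs_lp a).mul_left ‖f‖).hasSum fun x => ?_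
    rw [mul_comm ‖f‖]
    exact abs_mul_apply_le _ f x

theorem pairing_apply (f : C(L, ℝ)) (a : lp (fun _ : L => ℝ) 1) :
    pairing f a = ∑' x, a x * f x := rfl

theorem eq_zero_of_pairing_eq_zero [T2Space L] {a : lp (fun _ : L => ℝ) 1}
    (h : ∀ f : C(L, ℝ), pairing f a = 0) : a = 0 := by
  classical
  ext x₀
  by_contra hx
  have hpos : 0 < |a x₀| := abs_pos.2 hx
  have hs := summable_abs_lp a
  obtain ⟨F, hF⟩ := exists_mass_compl_lt hs.of_abs hpos
  obtain ⟨f, hf0, hf1, hf⟩ := exists_continuous_zero_one_of_isClosed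
    (s := ((F.erase x₀ : Finset L) : Set L)) (t := {x₀}) (Finset.finite_toSet _).isClosed
    isClosed_singleton (by simp)
  have hsingle : Summable fun x => if x = x₀ then a x₀ else 0 :=
    summable_of_ne_finset_zero (s := {x₀}) fun x hx =>
      if_neg (by simpa using hx)
  have key : |∑' x, (a x * f x - if x = x₀ then a x₀ else 0)| ≤ mass a (F : Set L)ᶜ := by
    refine tsum_of_norm_bounded (E := ℝ) (summable_mass hs.of_abs _).hasSum fun x => ?_
    by_cases hxx : x = x₀
    · subst hxx
      have : f x = 1 := hf1 rfl
      simpa [this] using indicator_nonneg (fun z _ => abs_nonneg (a z)) x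
    · by_cases hxF : x ∈ F
      · have : f x = 0 := hf0 (by simp [hxx, hxF])
        simp [this, hxx, hxF]
      · simp only [hxx, if_false, sub_zero, norm_mul, Real.norm_eq_abs]
        rw [indicator_of_mem (by simpa using hxF)]
        refine mul_le_of_le_one_right (abs_nonneg _) ?_
        rw [abs_of_nonneg (hf x).1]
        exact (hf x).2
  rw [(summable_mul_apply hs f).tsum_sub hsingle, ← pairing_apply, h f, tsum_ite_eq, zero_sub,
    abs_neg] at key
  exact absurd hF (not_lt.2 key)

theorem cauchySeq_of_seq_dist_tendsto {E : Type*} [PseudoMetricSpace E] {u : ℕ → E}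
    (h : ∀ m n : ℕ → ℕ, Tendsto m atTop atTop → Tendsto n atTop atTop →
      Tendsto (fun N => dist (u (m N)) (u (n N))) atTop (𝓝 0)) : CauchySeq u := by
  rw [cauchySeq_iff_tendsto_dist_atTop_0]
  refine tendsto_of_seq_tendsto fun x hx => ?_
  rw [← prod_atTop_atTop_eq] at hx
  exact h _ _ (tendsto_fst.comp hx) (tendsto_snd.comp hx)

theorem tendsto_norm_zero_of_pairing [T2Space L]
    (hA : ∀ d : ℕ → L → ℝ, (∀ k, Summable (d k)) → (∀ k, ∑' x, |d k x| ≤ 1) →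
      (∀ x, Tendsto (d · x) atTop (𝓝 0)) →
      (∀ f : C(L, ℝ), Tendsto (fun k => ∑' x, d k x * f x) atTop (𝓝 0)) →
      Tendsto (fun k => ∑' x, |d k x|) atTop (𝓝 0))
    {d : ℕ → lp (fun _ : L => ℝ) 1}
    (hd : ∀ f : C(L, ℝ), Tendsto (fun k => pairing f (d k)) atTop (𝓝 0)) :
    Tendsto (fun k => ‖d k‖) atTop (𝓝 0) := by
  by_contra hcon
  obtain ⟨ε, hε, hfr⟩ : ∃ ε > 0, ∃ᶠ k in atTop, ε ≤ ‖d k‖ := by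
    by_contra! h
    refine hcon (Metric.tendsto_nhds.2 fun ε hε => (h ε hε).mono fun k hk => ?_)
    simpa using hk
  obtain ⟨φ, hφ, hφε⟩ := extraction_of_frequently_atTop hfr
  let e : ℕ → lp (fun _ : L => ℝ) 1 := fun k => ‖d (φ k)‖⁻¹ • d (φ k)
  have hne : ∀ k, ‖d (φ k)‖ ≠ 0 := fun k => (hε.trans_le (hφε k)).ne'
  have he : ∀ k, ‖e k‖ = 1 := fun k => by
    simp only [e, norm_smul, norm_inv, norm_norm]
    exact inv_mul_cancel₀ (hne k)
  have hef : ∀ f : C(L, ℝ), Tendsto (fun k => pairing f (e k)) atTop (𝓝 0) := fun f => by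
    have h1 := (((hd f).comp hφ.tendsto_atTop).abs).const_mul ε⁻¹
    simp only [abs_zero, mul_zero] at h1
    refine squeeze_zero_norm (fun k => ?_) h1
    simp only [e, map_smul, smul_eq_mul, norm_mul, norm_inv, Function.comp,
      Real.norm_eq_abs]
    exact mul_le_mul_of_nonneg_right (inv_anti₀ hε (by simpa using hφε k)) (abs_nonneg _)
  obtain ⟨ψ, hψ, hlim⟩ := exists_subseq_pointwise fun k => (he k).le
  have hC : CauchySeq fun k => e (ψ k) := by
    refine cauchySeq_of_seq_dist_tendsto fun m n hm hn => ?_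
    have hval : ∀ N x, ((1 / 2 : ℝ) • (e (ψ (m N)) - e (ψ (n N))) : lp (fun _ : L => ℝ) 1) x =
        1 / 2 * (e (ψ (m N)) x - e (ψ (n N)) x) := fun N x => rfl
    have := hA (fun N => ((1 / 2 : ℝ) • (e (ψ (m N)) - e (ψ (n N))) : lp (fun _ : L => ℝ) 1))
      (fun N => (summable_abs_lp _).of_abs) (fun N => ?_) (fun x => ?_) (fun f => ?_)
    · simp only [← norm_lp_eq, norm_smul, ← dist_eq_norm] at this
      simpa using this.const_mul 2
    · rw [← norm_lp_eq, norm_smul]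
      have := norm_sub_le (e (ψ (m N))) (e (ψ (n N)))
      rw [he, he] at this
      rw [Real.norm_of_nonneg (by norm_num)]
      linarith
    · obtain ⟨l, hl⟩ := hlim x
      simp only [hval]
      have h1 := ((hl.comp hm).sub (hl.comp hn)).const_mul (1 / 2)
      rw [sub_self, mul_zero] at h1
      exact h1
    · have h1 := (hef f).comp hψ.tendsto_atTop
      have h2 := ((h1.comp hm).sub (h1.comp hn)).const_mul (1 / 2)
      simp only [sub_zero, mul_zero] at h2
      refine h2.congr fun N => ?_
      rw [← pairing_apply, map_smul, map_sub]
      rfl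
  obtain ⟨a, ha⟩ := cauchySeq_tendsto_of_complete hC
  have ha1 : ‖a‖ = 1 := tendsto_nhds_unique ha.norm (by simp [he])
  have ha0 : a = 0 := eq_zero_of_pairing_eq_zero fun f =>
    tendsto_nhds_unique (((pairing f).continuous.tendsto a).comp ha)
      ((hef f).comp hψ.tendsto_atTop)
  simp [ha0] at ha1

/-- A weak* convergent sequence in `ℓ¹` converges in norm. -/
theorem exists_tendsto_of_pairing [T2Space L]
    (hA : ∀ d : ℕ → L → ℝ, (∀ k, Summable (d k)) → (∀ k, ∑' x, |d k x| ≤ 1) →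
      (∀ x, Tendsto (d · x) atTop (𝓝 0)) →
      (∀ f : C(L, ℝ), Tendsto (fun k => ∑' x, d k x * f x) atTop (𝓝 0)) →
      Tendsto (fun k => ∑' x, |d k x|) atTop (𝓝 0))
    {a : ℕ → lp (fun _ : L => ℝ) 1}
    (ha : ∀ f : C(L, ℝ), ∃ l, Tendsto (fun k => pairing f (a k)) atTop (𝓝 l)) :
    ∃ b, Tendsto a atTop (𝓝 b) := by
  refine cauchySeq_tendsto_of_complete (cauchySeq_of_seq_dist_tendsto fun m n hm hn => ?_)
  simp only [dist_eq_norm]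
  refine tendsto_norm_zero_of_pairing hA fun f => ?_
  obtain ⟨l, hl⟩ := ha f
  simpa using (hl.comp hm).sub (hl.comp hn)

end EllOne

section Measures

variable {L : Type*} [MeasurableSpace L]

theorem apply_eq_posPart_sub_negPart (ν : SignedMeasure L)
    {E : Set L} (hE : MeasurableSet E) :
    ν E = ν.toJordanDecomposition.posPart.real E - ν.toJordanDecomposition.negPart.real E := by
  conv_lhs => rw [← SignedMeasure.toSignedMeasure_toJordanDecomposition ν]
  rw [JordanDecomposition.toSignedMeasure, _root_.sub_apply,
    Measure.toSignedMeasure_apply_measurable hE, Measure.toSignedMeasure_apply_measurable hE]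

theorem exists_parts_eq_restrict (ν : SignedMeasure L) :
    ∃ A, MeasurableSet A ∧ ν.toJordanDecomposition.posPart = ν.totalVariation.restrict Aᶜ ∧
      ν.toJordanDecomposition.negPart = ν.totalVariation.restrict A := by
  obtain ⟨A, hA, h1, h2⟩ := ν.toJordanDecomposition.mutuallySingular
  have hp : Aᶜ ∈ ae ν.toJordanDecomposition.posPart := by rwa [mem_ae_iff, compl_compl]
  have hn : A ∈ ae ν.toJordanDecomposition.negPart := mem_ae_iff.2 h2
  refine ⟨A, hA, ?_, ?_⟩
  · rw [SignedMeasure.totalVariation, Measure.restrict_add, Measure.restrict_eq_zero.2 h2, add_zero,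
      Measure.restrict_eq_self_of_ae_mem]
    exact hp
  · rw [SignedMeasure.totalVariation, Measure.restrict_add, Measure.restrict_eq_zero.2 h1, zero_add,
      Measure.restrict_eq_self_of_ae_mem]
    exact hn

instance (ν : SignedMeasure L) :
    IsFiniteMeasure ν.totalVariation := by
  unfold SignedMeasure.totalVariation
  infer_instance

theorem IsRadon.regular_parts [TopologicalSpace L] [T2Space L] [BorelSpace L]
    {ν : SignedMeasure L} (hν : IsRadon ν) :
    ν.toJordanDecomposition.posPart.Regular ∧ ν.toJordanDecomposition.negPart.Regular := by
  have : ν.totalVariation.Regular := hν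
  obtain ⟨A, -, h1, h2⟩ := exists_parts_eq_restrict ν
  rw [h1, h2]
  exact ⟨.restrict_of_measure_ne_top (measure_ne_top _ _),
    .restrict_of_measure_ne_top (measure_ne_top _ _)⟩

theorem tvNorm_le_tsum {ν : SignedMeasure L} {c : L → ℝ} (hc : Summable fun x => |c x|)
    (h : ∀ E, MeasurableSet E → ν E = ∑' x, E.indicator c x) : tvNorm ν ≤ ∑' x, |c x| := by
  obtain ⟨A, hA, h1, h2⟩ := ν.toJordanDecomposition.mutuallySingular
  have hA1 := apply_eq_posPart_sub_negPart ν hA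
  have hA2 := apply_eq_posPart_sub_negPart ν hA.compl
  have h3 : tvNorm ν = ν.toJordanDecomposition.posPart.real univ +
      ν.toJordanDecomposition.negPart.real univ := by
    rw [tvNorm, SignedMeasure.totalVariation, ← measureReal_def, measureReal_add_apply]
  rw [← measureReal_add_measureReal_compl hA, ← measureReal_add_measureReal_compl hA] at h3
  simp only [measureReal_def, h1, h2, ENNReal.toReal_zero] at hA1 hA2 h3
  have h4 : tvNorm ν = ν Aᶜ - ν A := by linarith
  rw [h4, h _ hA, h _ hA.compl, ← (hc.of_abs.indicator _).tsum_sub (hc.of_abs.indicator _)]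
  refine ((hc.of_abs.indicator _).sub (hc.of_abs.indicator _)).tsum_le_tsum (fun x => ?_) hc
  by_cases hx : x ∈ A
  · simpa [hx] using neg_le_abs (c x)
  · simpa [hx] using le_abs_self (c x)

theorem summable_measureReal_singleton [MeasurableSingletonClass L] (m : Measure L) [IsFiniteMeasure m] :
    Summable fun x => m.real {x} := by
  refine summable_of_sum_le (c := m.real univ) (fun _ => measureReal_nonneg) fun u => ?_
  rw [sum_measureReal_singleton]
  exact measureReal_mono (subset_univ _)

theorem integral_eq_tsum_of_countable [MeasurableSingletonClass L] {m : Measure L} [IsFiniteMeasure m] {S : Set L}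
    (hS : S.Countable) (hm : m Sᶜ = 0) {f : L → ℝ} (hf : Integrable f m) :
    ∫ x, f x ∂m = ∑' x, m.real {x} * f x := by
  have h1 : m.restrict S = m := Measure.restrict_eq_self_of_ae_mem (mem_ae_iff.2 hm)
  have h2 := setIntegral_countable f hS hf.integrableOn
  rw [h1] at h2
  rw [h2]
  simp only [smul_eq_mul]
  rw [tsum_subtype S fun x => m.real {x} * f x]
  refine tsum_congr fun x => ?_
  by_cases hx : x ∈ S
  · simp [hx]
  · have : m {x} = 0 := measure_mono_null (singleton_subset_iff.2 hx) hm
    simp [hx, measureReal_def, this]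

theorem mul_indicator_one {α : Type*} (c : α → ℝ) (E : Set α) (x : α) :
    c x * E.indicator (fun _ => (1 : ℝ)) x = E.indicator c x := by
  by_cases hx : x ∈ E <;> simp [hx]

theorem integral_indicator_one_eq (m : Measure L) {E : Set L}
    (hE : MeasurableSet E) : ∫ x, E.indicator (fun _ => (1 : ℝ)) x ∂m = m.real E := by
  rw [integral_indicator_const _ hE, smul_eq_mul, mul_one]

theorem totalVariation_compl_msupport [TopologicalSpace L] {ν : SignedMeasure L} (hν : IsRadon ν) :
    ν.totalVariation (msupport ν)ᶜ = 0 := by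
  have : ν.totalVariation.Regular := hν
  have hloc : ∀ x ∈ (msupport ν)ᶜ, ∃ U, IsOpen U ∧ x ∈ U ∧ ν.totalVariation U = 0 :=
    fun x hx => by simpa [msupport] using hx
  have hopen : IsOpen (msupport ν)ᶜ := isOpen_iff_forall_mem_open.2 fun x hx => by
    obtain ⟨U, hU, hxU, h0⟩ := hloc x hx
    exact ⟨U, fun y hy hy' => hy' U hU hy h0, hU, hxU⟩
  rw [hopen.measure_eq_iSup_isCompact]
  simp only [ENNReal.iSup_eq_zero]
  refine fun K hK hKc => hKc.measure_zero_of_nhdsWithin fun x hx => ?_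
  obtain ⟨U, hU, hxU, h0⟩ := hloc x (hK hx)
  exact ⟨U, mem_nhdsWithin_of_mem_nhds (hU.mem_nhds hxU), h0⟩

/-- A countably supported signed Radon measure is given by a summable family of point masses. -/
theorem exists_eq_tsum_of_countable [TopologicalSpace L] [CompactSpace L] [T2Space L] [BorelSpace L]
    {ν : SignedMeasure L} (hν : IsRadon ν)
    (hS : (msupport ν).Countable) :
    ∃ a : L → ℝ, Summable (fun x => |a x|) ∧
      (∀ f : C(L, ℝ), integ ν f = ∑' x, a x * f x) ∧
      ∀ E, MeasurableSet E → ν E = ∑' x, E.indicator a x := by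
  have h0 := totalVariation_compl_msupport hν
  rw [SignedMeasure.totalVariation, Measure.add_apply, add_eq_zero] at h0
  have hp := summable_measureReal_singleton ν.toJordanDecomposition.posPart
  have hn := summable_measureReal_singleton ν.toJordanDecomposition.negPart
  refine ⟨fun x => ν.toJordanDecomposition.posPart.real {x} -
    ν.toJordanDecomposition.negPart.real {x}, (hp.sub hn).abs, fun f => ?_, fun E hE => ?_⟩
  · have hb : ∀ (m : Measure L) [IsFiniteMeasure m], Integrable f m := fun m _ =>
      f.continuous.integrable_of_hasCompactSupport (HasCompactSupport.of_compactSpace _)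
    rw [integ, integral_eq_tsum_of_countable hS h0.1 (hb _),
      integral_eq_tsum_of_countable hS h0.2 (hb _), ← Summable.tsum_sub]
    · exact tsum_congr fun x => (sub_mul _ _ _).symm
    · exact summable_mul_apply hp.abs f
    · exact summable_mul_apply hn.abs f
  · have hb : ∀ (m : Measure L) [IsFiniteMeasure m], Integrable (E.indicator fun _ => (1 : ℝ)) m :=
      fun m _ => (integrable_const 1).indicator hE
    rw [apply_eq_posPart_sub_negPart ν hE, ← integral_indicator_one_eq _ hE,
      ← integral_indicator_one_eq _ hE, integral_eq_tsum_of_countable hS h0.1 (hb _),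
      integral_eq_tsum_of_countable hS h0.2 (hb _)]
    have hms : ∀ m : Measure L, (fun x => m.real {x} * E.indicator (fun _ => (1 : ℝ)) x) =
        E.indicator fun x => m.real {x} := fun m =>
      funext fun x => mul_indicator_one (fun x => m.real {x}) E x
    rw [hms, hms]
    rw [← (hp.indicator E).tsum_sub (hn.indicator E)]
    refine tsum_congr fun x => ?_
    by_cases hx : x ∈ E <;> simp [hx]

/-- The discrete measure whose point masses are the positive parts of a given family. -/
noncomputable def discrete (b : L → ℝ) : Measure L :=
  Measure.sum fun x => ENNReal.ofReal (b x) • Measure.dirac x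

instance [TopologicalSpace L] (x : L) :
    (Measure.dirac x).InnerRegular := by
  refine ⟨fun U hU r hr => ?_⟩
  rw [Measure.dirac_apply' _ hU] at hr
  by_cases hx : x ∈ U
  · refine ⟨{x}, singleton_subset_iff.2 hx, isCompact_singleton, ?_⟩
    rw [indicator_of_mem hx] at hr
    exact hr.trans_le (by simp)
  · simp [hx] at hr

theorem isFiniteMeasure_discrete {b : L → ℝ}
    (hb : Summable fun x => |b x|) : IsFiniteMeasure (discrete b) := by
  refine ⟨?_⟩
  rw [discrete, Measure.sum_apply _ MeasurableSet.univ]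
  simp only [Measure.smul_apply, measure_univ, smul_eq_mul, mul_one]
  refine lt_of_le_of_lt (ENNReal.tsum_le_tsum fun x => ?_) hb.tsum_ofReal_lt_top
  exact ENNReal.ofReal_le_ofReal (le_abs_self _)

theorem integral_discrete [MeasurableSingletonClass L] {b : L → ℝ} {f : L → ℝ} (hf : Integrable f (discrete b)) :
    ∫ x, f x ∂discrete b = ∑' x, max (b x) 0 * f x := by
  rw [discrete, integral_sum_measure hf]
  refine tsum_congr fun x => ?_
  rw [integral_smul_measure, integral_dirac, ENNReal.toReal_ofReal', smul_eq_mul]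

/-- A signed Radon measure agreeing on continuous functions with a summable family of point
masses agrees with it on all measurable sets. -/
theorem eq_tsum_of_integ_eq [TopologicalSpace L] [CompactSpace L] [T2Space L] [BorelSpace L]
    {ν : SignedMeasure L} (hν : IsRadon ν) {b : L → ℝ}
    (hb : Summable fun x => |b x|) (h : ∀ f : C(L, ℝ), integ ν f = ∑' x, b x * f x)
    {E : Set L} (hE : MeasurableSet E) : ν E = ∑' x, E.indicator b x := by
  have hb' : Summable fun x => |-b x| := by simpa using hb
  have := isFiniteMeasure_discrete hb
  have := isFiniteMeasure_discrete hb'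
  obtain ⟨hr1, hr2⟩ := hν.regular_parts
  have hinn : ∀ c : L → ℝ, (discrete c).InnerRegular := fun c => by
    unfold discrete
    infer_instance
  have := hinn b
  have := hinn fun x => -b x
  have hint : ∀ (f : C(L, ℝ)) (m : Measure L) [IsFiniteMeasure m], Integrable f m := fun f m _ =>
    f.continuous.integrable_of_hasCompactSupport (HasCompactSupport.of_compactSpace _)
  have hmax : ∀ {c g : L → ℝ}, Summable (fun x => |c x * g x|) →
      Summable fun x => max (c x) 0 * g x := fun {c g} hs =>
    Summable.of_norm_bounded hs fun x => by
      rw [norm_mul, abs_mul]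
      refine mul_le_mul_of_nonneg_right ?_ (abs_nonneg _)
      rw [Real.norm_of_nonneg (le_max_right _ _)]
      exact max_le (le_abs_self _) (abs_nonneg _)
  have hsub : ∀ g : L → ℝ, Summable (fun x => |b x * g x|) →
      ∑' x, max (b x) 0 * g x - ∑' x, max (-b x) 0 * g x = ∑' x, b x * g x := fun g hs => by
    rw [← (hmax hs).tsum_sub (hmax (by simpa using hs))]
    refine tsum_congr fun x => ?_
    rw [← sub_mul, max_zero_sub_max_neg_zero_eq_self]
  have key : ν.toJordanDecomposition.posPart + discrete (fun x => -b x) =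
      ν.toJordanDecomposition.negPart + discrete b := by
    refine Measure.ext_of_integral_eq_on_compactlySupported fun f => ?_
    have h1 := h f.toContinuousMap
    have h2 := hsub f.toContinuousMap (summable_mul_apply hb f.toContinuousMap).abs
    rw [integ] at h1
    have h3 := fun (m : Measure L) [IsFiniteMeasure m] => hint f.toContinuousMap m
    change ∫ x, f.toContinuousMap x ∂_ = ∫ x, f.toContinuousMap x ∂_
    rw [integral_add_measure (h3 _) (h3 _), integral_add_measure (h3 _) (h3 _),
      integral_discrete (h3 _), integral_discrete (h3 _)]
    linarith
  have hreal : (ν.toJordanDecomposition.posPart + discrete fun x => -b x).real E =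
      (ν.toJordanDecomposition.negPart + discrete b).real E := by rw [key]
  rw [measureReal_add_apply, measureReal_add_apply] at hreal
  have hone : ∀ (m : Measure L) [IsFiniteMeasure m], Integrable (E.indicator fun _ => (1 : ℝ)) m :=
    fun m _ => (integrable_const 1).indicator hE
  have h2 := hsub (E.indicator fun _ => (1 : ℝ)) (by
    simp only [mul_indicator_one]
    exact (hb.of_abs.indicator E).abs)
  rw [← integral_discrete (hone _), ← integral_discrete (b := fun x => -b x) (hone _),
    integral_indicator_one_eq _ hE, integral_indicator_one_eq _ hE] at h2
  rw [tsum_congr (mul_indicator_one b E)] at h2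
  rw [apply_eq_posPart_sub_negPart ν hE, ← h2]
  linarith

theorem ell1Grothendieck_of_tendsto [TopologicalSpace L] [CompactSpace L] [T2Space L] [BorelSpace L]
    (hA : ∀ d : ℕ → L → ℝ, (∀ k, Summable (d k)) → (∀ k, ∑' x, |d k x| ≤ 1) →
      (∀ x, Tendsto (d · x) atTop (𝓝 0)) →
      (∀ f : C(L, ℝ), Tendsto (fun k => ∑' x, d k x * f x) atTop (𝓝 0)) →
      Tendsto (fun k => ∑' x, |d k x|) atTop (𝓝 0)) : Ell1Grothendieck L := by
  intro μs μ hμs hsupp hμ hw φ ⟨C, hC⟩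
  choose a ha hai haE using fun n => exists_eq_tsum_of_countable (hμs n) (hsupp n)
  let α : ℕ → lp (fun _ : L => ℝ) 1 := fun n => ⟨a n, memℓp_gen (by simpa using ha n)⟩
  have hpair : ∀ f : C(L, ℝ), Tendsto (fun k => pairing f (α k)) atTop (𝓝 (integ μ f)) :=
    fun f => (hw f).congr fun k => hai k f
  obtain ⟨b, hb⟩ := exists_tendsto_of_pairing hA fun f => ⟨_, hpair f⟩
  have hbE := fun E => eq_tsum_of_integ_eq (E := E) hμ (summable_abs_lp b) fun f =>
    tendsto_nhds_unique (hpair f) (((pairing f).continuous.tendsto b).comp hb)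
  have hnorm : ∀ n, tvNorm (μs n - μ) ≤ ‖α n - b‖ := fun n => by
    rw [norm_lp_eq]
    refine tvNorm_le_tsum (summable_abs_lp _) fun E hE => ?_
    rw [_root_.sub_apply, haE n E hE, hbE E hE,
      ← ((ha n).of_abs.indicator E).tsum_sub ((summable_abs_lp b).of_abs.indicator E)]
    refine tsum_congr fun x => ?_
    rw [lp.coeFn_sub, indicator_sub']
    rfl
  have h0 : Tendsto (fun n => |C| * ‖α n - b‖) atTop (𝓝 0) := by
    simpa using (tendsto_iff_norm_sub_tendsto_zero.1 hb).const_mul |C|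
  rw [tendsto_iff_norm_sub_tendsto_zero]
  refine squeeze_zero (fun n => norm_nonneg _) (fun n => ?_) h0
  rw [← map_sub]
  refine (hC _).trans ?_
  have hnn : 0 ≤ tvNorm (μs n - μ) := ENNReal.toReal_nonneg
  exact (mul_le_mul_of_nonneg_right (le_abs_self C) hnn).trans
    (mul_le_mul_of_nonneg_left (hnorm n) (abs_nonneg C))

end Measures

section NotGrothendieck

open CompactlySupported

theorem toJordanDecomposition_measure {L : Type*} [MeasurableSpace L] (m : Measure L)
    [IsFiniteMeasure m] : m.toSignedMeasure.toJordanDecomposition =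
      { posPart := m, negPart := 0, mutuallySingular := Measure.MutuallySingular.zero_right } :=
  SignedMeasure.toJordanDecomposition_eq (by
    simp [JordanDecomposition.toSignedMeasure])

theorem isRadon_toSignedMeasure {L : Type*} [TopologicalSpace L] [MeasurableSpace L]
    (m : Measure L) [IsFiniteMeasure m] (hm : m.Regular) : IsRadon m.toSignedMeasure := by
  rw [IsRadon, SignedMeasure.totalVariation, toJordanDecomposition_measure]
  simpa using hm

theorem integ_toSignedMeasure {L : Type*} [MeasurableSpace L] (m : Measure L)
    [IsFiniteMeasure m] (f : L → ℝ) : integ m.toSignedMeasure f = ∫ x, f x ∂m := by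
  rw [integ, toJordanDecomposition_measure]
  simp

theorem abs_apply_le_tvNorm {L : Type*} [MeasurableSpace L] (ν : SignedMeasure L) {E : Set L}
    (hE : MeasurableSet E) : |ν E| ≤ tvNorm ν := by
  have h : tvNorm ν = ν.toJordanDecomposition.posPart.real univ +
      ν.toJordanDecomposition.negPart.real univ := by
    rw [tvNorm, SignedMeasure.totalVariation, ← measureReal_def, measureReal_add_apply]
  have h1 : ν.toJordanDecomposition.posPart.real E ≤ ν.toJordanDecomposition.posPart.real univ :=
    measureReal_mono (subset_univ E)
  have h2 : ν.toJordanDecomposition.negPart.real E ≤ ν.toJordanDecomposition.negPart.real univ :=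
    measureReal_mono (subset_univ E)
  have h3 : 0 ≤ ν.toJordanDecomposition.posPart.real E := measureReal_nonneg
  have h4 : 0 ≤ ν.toJordanDecomposition.negPart.real E := measureReal_nonneg
  rw [apply_eq_posPart_sub_negPart ν hE, h, abs_le]
  constructor <;> linarith

/-- The functional averaging a continuous function along a column. -/
noncomputable def columnMean (n : ℕ) : C_c(Space, ℝ) →ₚ[ℝ] ℝ :=
  have hb : ∀ (f : C_c(Space, ℝ)) (i : ℕ), |f (point (n, i))| ≤ ‖f.toContinuousMap‖ :=
    fun f _ => f.toContinuousMap.norm_coe_le_norm _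
  { toFun := fun f => ultraMean fun i => f (point (n, i))
    map_add' := fun f g => ultraMean_add (hb f) (hb g)
    map_smul' := fun r f => ultraMean_const_mul (hb f) r
    monotone' := fun f g hfg => ultraMean_mono (hb f) (hb g) fun _ => hfg _ }

/-- The measure averaging continuous functions along a column. -/
noncomputable def columnMeasure (n : ℕ) : Measure Space := RealRMK.rieszMeasure (columnMean n)

instance (n : ℕ) : IsFiniteMeasure (columnMeasure n) :=
  inferInstanceAs (IsFiniteMeasure (RealRMK.rieszMeasure (columnMean n)))

theorem integral_columnMeasure (n : ℕ) (f : C(Space, ℝ)) :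
    ∫ x, f x ∂columnMeasure n = ultraMean fun i => f (point (n, i)) :=
  RealRMK.integral_rieszMeasure (columnMean n) ⟨f, HasCompactSupport.of_compactSpace _⟩

theorem columnMeasure_infty (n : ℕ) : (columnMeasure n).real {OnePoint.infty} = 0 := by
  have hD := (isClopen_basic (small_column n)).isOpen.measurableSet
  have h1 : (columnMeasure n).real (basic (column n)) = 1 := by
    rw [← integral_indicator_one_eq _ hD]
    refine (integral_columnMeasure n (basicInd (small_column n))).trans ?_
    have : ∀ i, basicInd (small_column n) (point (n, i)) = 1 := fun i =>
      indicator_of_mem (point_mem_basic.2 (show (n, i) ∈ column n from rfl)) fun _ => (1 : ℝ)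
    simp only [this, ultraMean_const]
  have h2 : (columnMeasure n).real univ = 1 := by
    have := integral_columnMeasure n (.const _ 1)
    simpa [ultraMean_const] using this
  have h3 := measureReal_add_measureReal_compl (μ := columnMeasure n) hD
  refine le_antisymm ?_ measureReal_nonneg
  have h4 : (columnMeasure n).real {OnePoint.infty} ≤ (columnMeasure n).real (basic (column n))ᶜ :=
    measureReal_mono (singleton_subset_iff.2 infty_notMem_basic)
  linarith

theorem ultraMean_add_mul_indicator (c a : ℝ) (n : ℕ) (B : Set (ℕ × ℕ)) :
    ultraMean (fun i => c + a * B.indicator (fun _ => (1 : ℝ)) (n, i)) = c + a * dens n B := by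
  rw [ultraMean_add (C := |c|) (D := |a| * 1) (fun _ => le_rfl) fun i => ?_, ultraMean_const,
    ultraMean_const_mul fun i => abs_indicator_one_le B (n, i), dens]
  rw [abs_mul]
  exact mul_le_mul_of_nonneg_left (abs_indicator_one_le B _) (abs_nonneg a)

theorem abs_add_mul_indicator_le (c a : ℝ) (B : Set (ℕ × ℕ)) (y : ℕ × ℕ) :
    |c + a * B.indicator (fun _ => (1 : ℝ)) y| ≤ |c| + |a| := by
  refine (abs_add_le _ _).trans (add_le_add_right ?_ _)
  rw [abs_mul]
  exact mul_le_of_le_one_right (abs_nonneg a) (abs_indicator_one_le B y)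

theorem tendsto_integral_columnMeasure (f : C(Space, ℝ)) :
    Tendsto (fun n => ∫ x, f x ∂columnMeasure n) atTop (𝓝 (f OnePoint.infty)) := by
  rw [Metric.tendsto_nhds]
  intro ε hε
  obtain ⟨B, hB, hfB⟩ := exists_small_of_isClosed
    (C := {x | ε / 2 ≤ |f x - f OnePoint.infty|})
    (isClosed_le continuous_const (f.continuous.sub continuous_const).abs) (by simpa using hε)
  have hlim : Tendsto (fun n => 2 * ‖f‖ * dens n B) atTop (𝓝 0) := by
    simpa using Tendsto.const_mul (2 * ‖f‖) hB
  refine (hlim.eventually_lt_const (half_pos hε)).mono fun n hn => ?_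
  have hfn : ∀ x, |f x| ≤ ‖f‖ := f.norm_coe_le_norm
  have hclose : ∀ i, |f (point (n, i)) - f OnePoint.infty| ≤
      ε / 2 + 2 * ‖f‖ * B.indicator (fun _ => (1 : ℝ)) (n, i) := fun i => by
    by_cases hi : (n, i) ∈ B
    · rw [indicator_of_mem hi, mul_one]
      refine (abs_sub _ _).trans ?_
      linarith [hfn (point (n, i)), hfn OnePoint.infty]
    · have hlt : |f (point (n, i)) - f OnePoint.infty| < ε / 2 :=
        lt_of_not_ge fun h => hi (point_mem_basic.1 (hfB h))
      simpa [hi] using hlt.le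
  have hup := fun i => (abs_le.1 (hclose i)).2
  have hlo := fun i => (abs_le.1 (hclose i)).1
  rw [integral_columnMeasure, Real.dist_eq, abs_lt]
  constructor
  · have h := ultraMean_mono (fun i =>
      abs_add_mul_indicator_le (f OnePoint.infty - ε / 2) (-(2 * ‖f‖)) B (n, i))
      (fun i => hfn (point (n, i))) fun i => by linarith [hlo i]
    rw [ultraMean_add_mul_indicator] at h
    linarith
  · have h := ultraMean_mono (fun i => hfn (point (n, i)))
      (fun i => abs_add_mul_indicator_le (f OnePoint.infty + ε / 2) (2 * ‖f‖) B (n, i))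
      fun i => by linarith [hup i]
    rw [ultraMean_add_mul_indicator] at h
    linarith

theorem not_grothendieckProp_space : ¬ GrothendieckProp Space := by
  intro h
  have hreg : (Measure.dirac (OnePoint.infty : Space)).Regular := inferInstance
  have hw := h (fun n => (columnMeasure n).toSignedMeasure)
    (Measure.dirac (OnePoint.infty : Space)).toSignedMeasure
    (fun n => isRadon_toSignedMeasure _ (RealRMK.regular_rieszMeasure (columnMean n)))
    (isRadon_toSignedMeasure _ hreg) (fun f => by
      simp only [integ_toSignedMeasure, integral_dirac]
      exact tendsto_integral_columnMeasure f)
    { toFun := fun ν => ν {OnePoint.infty}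
      map_add' := fun _ _ => rfl
      map_smul' := fun _ _ => rfl }
    ⟨1, fun ν => by
      rw [one_mul]
      exact abs_apply_le_tvNorm ν (measurableSet_singleton _)⟩
  have h0 : ∀ n, (columnMeasure n).toSignedMeasure {(OnePoint.infty : Space)} = 0 := fun n => by
    rw [Measure.toSignedMeasure_apply_measurable (measurableSet_singleton _), columnMeasure_infty]
  have h1 : (Measure.dirac (OnePoint.infty : Space)).toSignedMeasure {OnePoint.infty} = 0 :=
    tendsto_nhds_unique hw (tendsto_const_nhds.congr fun n => (h0 n).symm)
  rw [Measure.toSignedMeasure_apply_measurable (measurableSet_singleton _)] at h1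
  simp [measureReal_def] at h1

end NotGrothendieck

end JNP

/-- There exists a separable infinite compact Hausdorff space without the Grothendieck
property but with the ℓ₁-Grothendieck property. -/
theorem stmt_8 :
    ∃ (L : Type) (_ : TopologicalSpace L) (_ : MeasurableSpace L) (_ : BorelSpace L),
      CompactSpace L ∧ T2Space L ∧ Infinite L ∧ TopologicalSpace.SeparableSpace L ∧
      ¬ JNP.GrothendieckProp L ∧ JNP.Ell1Grothendieck L := by
  exact ⟨JNP.Space, inferInstance, inferInstance, inferInstance, inferInstance, inferInstance,
    inferInstance, inferInstance, JNP.not_grothendieckProp_space,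
    JNP.ell1Grothendieck_of_tendsto fun _ => JNP.tendsto_mass_zero⟩
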